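/- arXiv:2504.18862 — 2 statements merged into one kernel-verified Lean document; each statement's English description precedes it below -/
import Mathlib

section
/- For every ε > 0 there is a constant C > 0 such that for every real T ≥ 10 and every real y with 1 ≤ y ≤ T^{1/12}, one has ∫_T^{2T} |∑_{y < n ≤ T^{1/2}} (c_n/n^{7/8}) e(4(nx)^{1/4})|⁴ dx ≤ C · T^{1+ε} y^{−3/2}, where e(t) = e^{2πit}. -/
open Real Finset

/-- The signs of the quadrilinear form `x₀ + x₁ - x₂ - x₃`. -/
noncomputable def quadSign : Fin 4 → ℝ := ![1, 1, -1, -1]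

lemma abs_quadSign (i : Fin 4) : |quadSign i| = 1 := by
  fin_cases i <;> simp [quadSign]

lemma quadSign_mul_self (i : Fin 4) : quadSign i * quadSign i = 1 := by
  fin_cases i <;> simp [quadSign]

lemma exists_rpow_lipschitz (α Λ : ℝ) (hΛ : 1 ≤ Λ) :
    ∃ C : ℝ, 0 < C ∧ ∀ x : ℝ, 1 / Λ ≤ x → x ≤ Λ → |x ^ α - 1| ≤ C * |x - 1| := by
  have hΛ0 : 0 < Λ := by linarith
  have hinv : 1 / Λ ≤ 1 := by rw [div_le_one hΛ0]; exact hΛ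
  have hpos : 0 < 1 / Λ := by positivity
  have hcont : ContinuousOn (fun x : ℝ => α * x ^ (α - 1)) (Set.Icc (1 / Λ) Λ) := by
    apply ContinuousOn.mul continuousOn_const
    exact continuousOn_id.rpow_const fun x hx => Or.inl (ne_of_gt (lt_of_lt_of_le hpos hx.1))
  obtain ⟨C, hC⟩ := isCompact_Icc.exists_bound_of_continuousOn hcont
  refine ⟨|C| + 1, by positivity, fun x hx1 hx2 => ?_⟩
  have := Convex.norm_image_sub_le_of_norm_hasDerivWithin_le (f := fun x : ℝ => x ^ α)
    (f' := fun x => α * x ^ (α - 1)) (s := Set.Icc (1 / Λ) Λ) (x := 1) (y := x) (C := C)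
    (fun y hy => (Real.hasDerivAt_rpow_const
      (Or.inl (ne_of_gt (lt_of_lt_of_le hpos hy.1)))).hasDerivWithinAt)
    hC (convex_Icc _ _) ⟨hinv, hΛ⟩ ⟨hx1, hx2⟩
  simp only [Real.one_rpow, Real.norm_eq_abs] at this
  refine this.trans ?_
  gcongr
  linarith [le_abs_self C]

lemma exists_rpow_taylor (α Λ : ℝ) (hΛ : 1 ≤ Λ) :
    ∃ C : ℝ, 0 < C ∧ ∀ x : ℝ, 1 / Λ ≤ x → x ≤ Λ →
      |x ^ α - 1 - α * (x - 1)| ≤ C * (x - 1) ^ 2 := by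
  have hΛ0 : 0 < Λ := by linarith
  have hinv : 1 / Λ ≤ 1 := by rw [div_le_one hΛ0]; exact hΛ
  have hpos : 0 < 1 / Λ := by positivity
  obtain ⟨L, hL0, hL⟩ := exists_rpow_lipschitz (α - 1) Λ hΛ
  refine ⟨(|α| + 1) * L, by positivity, fun x hx1 hx2 => ?_⟩
  have hsub : Set.uIcc 1 x ⊆ Set.Icc (1 / Λ) Λ :=
    Set.uIcc_subset_Icc ⟨hinv, hΛ⟩ ⟨hx1, hx2⟩
  have := Convex.norm_image_sub_le_of_norm_hasDerivWithin_le
    (f := fun x : ℝ => x ^ α - 1 - α * (x - 1))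
    (f' := fun x => α * x ^ (α - 1) - α * 1) (s := Set.uIcc 1 x) (x := 1) (y := x)
    (C := |α| * (L * |x - 1|))
    (fun y hy => ((((Real.hasDerivAt_rpow_const
      (Or.inl (ne_of_gt (lt_of_lt_of_le hpos (hsub hy).1)))).sub_const 1).sub
        (((hasDerivAt_id y).sub_const 1).const_mul α))).hasDerivWithinAt)
    (fun y hy => by
      rw [← mul_sub, Real.norm_eq_abs, abs_mul]
      refine mul_le_mul_of_nonneg_left ((hL y (hsub hy).1 (hsub hy).2).trans ?_) (abs_nonneg _)
      exact mul_le_mul_of_nonneg_left (Set.abs_sub_left_of_mem_uIcc hy) hL0.le)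
    (convex_uIcc _ _) Set.left_mem_uIcc Set.right_mem_uIcc
  simp only [Real.one_rpow, Real.norm_eq_abs, sub_self, mul_zero, sub_zero] at this
  refine this.trans ?_
  rw [← sq_abs (x - 1)]
  have h1 : 0 ≤ L * |x - 1| * |x - 1| := by positivity
  nlinarith

lemma exists_linearization (α Λ : ℝ) (hΛ : 1 ≤ Λ) :
    ∃ C : ℝ, 0 < C ∧ ∀ (p x : Fin 4 → ℝ) (P d : ℝ), (∀ i, |p i| ≤ P) →
      (∀ i, 1 / Λ ≤ x i ∧ x i ≤ Λ) → (∀ i, |x i - 1| ≤ d) →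
      |∑ i, quadSign i * p i * x i ^ α - α * ∑ i, quadSign i * p i * x i| ≤
        |1 - α| * |∑ i, quadSign i * p i| + C * P * d ^ 2 := by
  obtain ⟨C, hC0, hC⟩ := exists_rpow_taylor α Λ hΛ
  refine ⟨4 * C, by positivity, fun p x P d hp hx hd => ?_⟩
  have hsplit : ∑ i, quadSign i * p i * x i ^ α - α * ∑ i, quadSign i * p i * x i =
      (1 - α) * ∑ i, quadSign i * p i +
        ∑ i, quadSign i * p i * (x i ^ α - 1 - α * (x i - 1)) := by
    simp only [mul_sum, ← sum_add_distrib, ← sum_sub_distrib]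
    exact sum_congr rfl fun i _ => by ring
  rw [hsplit]
  refine (abs_add_le _ _).trans ?_
  rw [abs_mul]
  gcongr
  refine (abs_sum_le_sum_abs _ _).trans ?_
  have hterm : ∀ i ∈ (univ : Finset (Fin 4)),
      |quadSign i * p i * (x i ^ α - 1 - α * (x i - 1))| ≤ P * (C * d ^ 2) := by
    intro i _
    rw [abs_mul, abs_mul, abs_quadSign, one_mul]
    have hP : 0 ≤ P := (abs_nonneg _).trans (hp i)
    have h2 : (x i - 1) ^ 2 ≤ d ^ 2 := by
      rw [← sq_abs (x i - 1)]
      exact pow_le_pow_left₀ (abs_nonneg _) (hd i) 2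
    refine mul_le_mul (hp i) ((hC _ (hx i).1 (hx i).2).trans ?_) (abs_nonneg _) hP
    gcongr
  refine (sum_le_sum hterm).trans ?_
  simp only [sum_const, card_univ, Fintype.card_fin, nsmul_eq_mul]
  push_cast
  linarith

lemma sum_stdAddChar_mul_eq_zero {R : ℕ} [NeZero R] {d : ZMod R} (hd : d ≠ 0) :
    ∑ τ : ZMod R, ZMod.stdAddChar (d * τ) = 0 := by
  have := AddChar.sum_mulShift (R := ZMod R) (R' := ℂ) d (ψ := ZMod.stdAddChar)
    (ZMod.isPrimitive_stdAddChar R)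
  simp only [hd, if_false] at this
  simpa [mul_comm] using this

lemma sum_stdAddChar_dot {R : ℕ} [NeZero R] (d : Fin 4 → ZMod R) :
    ∑ τ : Fin 4 → ZMod R, ZMod.stdAddChar (∑ i, d i * τ i) =
      if d = 0 then (R : ℂ) ^ 4 else 0 := by
  have h1 : ∀ τ : Fin 4 → ZMod R, (ZMod.stdAddChar (∑ i, d i * τ i) : ℂ) =
      ∏ i, ZMod.stdAddChar (d i * τ i) := fun τ => by
    simp only [Fin.sum_univ_four, Fin.prod_univ_four, AddChar.map_add_eq_mul]
  simp only [h1]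
  rw [← Fintype.piFinset_univ, ← Finset.prod_univ_sum (fun _ => (univ : Finset (ZMod R)))
    (fun i t => (ZMod.stdAddChar (d i * t) : ℂ))]
  split_ifs with h
  · simp [h, ZMod.card]
  · obtain ⟨i, hi⟩ := Function.ne_iff.mp h
    exact prod_eq_zero (mem_univ i) (sum_stdAddChar_mul_eq_zero hi)

lemma sum_norm_sq_exponential {R : ℕ} [NeZero R] (F : Finset (Fin 4 → ℤ))
    (hF : ∀ n ∈ F, ∀ n' ∈ F, (∀ i, (n i : ZMod R) = n' i) → n = n') :
    ∑ τ : Fin 4 → ZMod R, ‖∑ n ∈ F, ZMod.stdAddChar (∑ i, (n i : ZMod R) * τ i)‖ ^ 2 =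
      (R : ℝ) ^ 4 * #F := by
  have key : ∑ τ : Fin 4 → ZMod R,
      ((‖∑ n ∈ F, ZMod.stdAddChar (∑ i, (n i : ZMod R) * τ i)‖ ^ 2 : ℝ) : ℂ) =
      (R : ℂ) ^ 4 * #F := by
    have h1 : ∀ τ : Fin 4 → ZMod R,
        ((‖∑ n ∈ F, ZMod.stdAddChar (∑ i, (n i : ZMod R) * τ i)‖ ^ 2 : ℝ) : ℂ) =
        ∑ n ∈ F, ∑ n' ∈ F, ZMod.stdAddChar (∑ i, ((n i : ZMod R) - (n' i : ZMod R)) * τ i) := by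
      intro τ
      push_cast
      rw [← Complex.mul_conj', map_sum, sum_mul_sum]
      refine sum_congr rfl fun n _ => sum_congr rfl fun n' _ => ?_
      rw [← AddChar.map_neg_eq_conj, ← AddChar.map_add_eq_mul, ← sub_eq_add_neg,
        ← sum_sub_distrib]
      congr 1
      exact sum_congr rfl fun i _ => by ring
    simp only [h1]
    rw [sum_comm]
    have h2 : ∀ n ∈ F, ∑ τ : Fin 4 → ZMod R, ∑ n' ∈ F,
        (ZMod.stdAddChar (∑ i, ((n i : ZMod R) - (n' i : ZMod R)) * τ i) : ℂ) = (R : ℂ) ^ 4 := by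
      intro n hn
      rw [sum_comm, sum_eq_single_of_mem n hn]
      · simp [ZMod.card]
      · intro n' hn' hne
        rw [sum_stdAddChar_dot (fun i => (n i : ZMod R) - (n' i : ZMod R)), if_neg]
        intro h0
        exact hne (hF n hn n' hn' fun i => sub_eq_zero.mp (congrFun h0 i)).symm
    rw [sum_congr rfl h2, sum_const, nsmul_eq_mul, mul_comm]
  exact_mod_cast key

lemma half_le_re_stdAddChar {R : ℕ} [NeZero R] (a : ℤ) (ha : |(a : ℝ)| ≤ R / 6) :
    1 / 2 ≤ (ZMod.stdAddChar (a : ZMod R) : ℂ).re := by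
  have hR : (0 : ℝ) < R := Nat.cast_pos.mpr (NeZero.pos R)
  rw [ZMod.stdAddChar_coe]
  have : (2 * π * Complex.I * a / R : ℂ) = ((2 * π * a / R : ℝ) : ℂ) * Complex.I := by
    push_cast; ring
  rw [this, Complex.exp_ofReal_mul_I_re, ← Real.cos_pi_div_three, ← Real.cos_abs (2 * π * a / R)]
  apply Real.cos_le_cos_of_nonneg_of_le_pi (abs_nonneg _) (by linarith [Real.pi_pos])
  rw [abs_div, abs_mul, abs_of_pos hR, abs_of_pos Real.two_pi_pos, div_le_iff₀ hR]
  nlinarith [Real.pi_pos]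

/-- A transference inequality: if all inner products between two finite sets of lattice points
are small modulo `R`, then the product of their sizes is controlled by the number of differences
of the second set lying in `R ℤ⁴`. -/
lemma exists_card_mul_card_le (R : ℕ) [NeZero R] (F T : Finset (Fin 4 → ℤ))
    (hF : ∀ n ∈ F, ∀ n' ∈ F, (∀ i, (n i : ZMod R) = n' i) → n = n')
    (hFT : ∀ n ∈ F, ∀ t ∈ T, |((∑ i, n i * t i : ℤ) : ℝ)| ≤ R / 6) :
    ∃ K : Finset (Fin 4 → ℤ),
      (∀ k ∈ K, ∃ t ∈ T, ∃ t' ∈ T, ∀ i, t i - t' i = R * k i) ∧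
      (#F : ℝ) * #T ≤ 4 * R ^ 4 * #K := by
  classical
  set red : (Fin 4 → ℤ) → (Fin 4 → ZMod R) := fun t i => t i with hred
  set K : Finset (Fin 4 → ℤ) :=
    ((T ×ˢ T).filter fun q => red q.1 = red q.2).image
      fun q i => (q.1 i - q.2 i) / (R : ℤ) with hK
  have hdvd : ∀ t t' : Fin 4 → ℤ, red t = red t' → ∀ i, (R : ℤ) ∣ t i - t' i := by
    intro t t' h i
    have := congrFun h i
    simp only [hred] at this
    rw [← ZMod.intCast_zmod_eq_zero_iff_dvd]
    push_cast
    rw [this, sub_self]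
  refine ⟨K, ?_, ?_⟩
  · intro k hk
    obtain ⟨⟨t, t'⟩, hq, rfl⟩ := mem_image.mp hk
    simp only [mem_filter, mem_product] at hq
    exact ⟨t, hq.1.1, t', hq.1.2, fun i => (Int.mul_ediv_cancel' (hdvd _ _ hq.2 i)).symm⟩
  set g : (Fin 4 → ZMod R) → ℝ :=
    fun τ => ‖∑ n ∈ F, (ZMod.stdAddChar (∑ i, (n i : ZMod R) * τ i) : ℂ)‖ ^ 2 with hg
  have hlow : ∀ t ∈ T, ((#F : ℝ) / 2) ^ 2 ≤ g (red t) := by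
    intro t ht
    refine pow_le_pow_left₀ (by positivity) ?_ 2
    refine le_trans ?_ (Complex.re_le_norm _)
    rw [Complex.re_sum]
    have : ∀ n ∈ F, (1 / 2 : ℝ) ≤
        (ZMod.stdAddChar (∑ i, (n i : ZMod R) * red t i) : ℂ).re := by
      intro n hn
      have := half_le_re_stdAddChar (R := R) _ (hFT n hn t ht)
      push_cast at this
      simpa [hred] using this
    refine le_trans ?_ (sum_le_sum this)
    simp [div_eq_mul_inv]
  have hfib : ∀ τ : Fin 4 → ZMod R, #(T.filter fun t => red t = τ) ≤ #K := by
    intro τ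
    rcases (T.filter fun t => red t = τ).eq_empty_or_nonempty with h | ⟨t₀, ht₀⟩
    · simp [h]
    rw [mem_filter] at ht₀
    refine card_le_card_of_injOn (fun t i => (t i - t₀ i) / (R : ℤ)) ?_ ?_
    · intro t ht
      simp only [coe_filter, Set.mem_ofPred_eq] at ht
      refine mem_coe.mpr (mem_image.mpr ⟨(t, t₀), ?_, rfl⟩)
      simp [ht.1, ht.2, ht₀.1, ht₀.2]
    · intro t ht t' ht' h
      simp only [coe_filter, Set.mem_ofPred_eq] at ht ht'
      funext i
      have h1 := congrFun h i
      simp only at h1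
      have h2 := Int.mul_ediv_cancel' (hdvd t t₀ (ht.2.trans ht₀.2.symm) i)
      have h3 := Int.mul_ediv_cancel' (hdvd t' t₀ (ht'.2.trans ht₀.2.symm) i)
      rw [h1, h3] at h2
      linarith
  have hup : ∑ t ∈ T, g (red t) ≤ #K * ∑ τ, g τ := by
    rw [← sum_fiberwise_of_maps_to (g := red) (t := univ) (fun _ _ => mem_univ _), mul_sum]
    refine sum_le_sum fun τ _ => ?_
    rw [sum_congr rfl (g := fun _ => g τ) (fun t ht => by rw [(mem_filter.mp ht).2]), sum_const,
      nsmul_eq_mul]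
    exact mul_le_mul_of_nonneg_right (by exact_mod_cast hfib τ) (by positivity)
  have htot : ∑ τ, g τ = (R : ℝ) ^ 4 * #F := sum_norm_sq_exponential F hF
  have hsum : (#T : ℝ) * ((#F : ℝ) / 2) ^ 2 ≤ #K * ((R : ℝ) ^ 4 * #F) := by
    rw [← htot]
    refine le_trans ?_ hup
    rw [← nsmul_eq_mul]
    exact card_nsmul_le_sum _ _ _ hlow
  rcases Nat.eq_zero_or_pos #F with h0 | h0
  · rw [h0]; push_cast; rw [zero_mul]; positivity
  · have h0' : (0 : ℝ) < #F := by exact_mod_cast h0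
    refine le_of_mul_le_mul_right ?_ h0'
    nlinarith

lemma exists_skew_box (m : Fin 4 → ℝ) (hm : 0 < m 0) (g₁ g₂ : ℝ) (a : Fin 4 → ℝ)
    (ha : ∀ i, 1 ≤ a i) :
    ∃ T : Finset (Fin 4 → ℤ),
      (∀ t ∈ T, (0 ≤ (t 3 : ℝ) ∧ (t 3 : ℝ) ≤ a 3) ∧
        (0 ≤ t 1 - g₁ * t 3 ∧ t 1 - g₁ * t 3 ≤ a 1) ∧
        (0 ≤ t 2 - g₂ * t 3 ∧ t 2 - g₂ * t 3 ≤ a 2) ∧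
        (0 ≤ ∑ i, m i * t i ∧ ∑ i, m i * t i ≤ m 0 * a 0)) ∧
      (∏ i, a i) / 16 ≤ #T := by
  classical
  set t1 : (Fin 4 → ℕ) → ℤ := fun b => ⌈g₁ * (b 3 : ℝ)⌉ + b 1 with ht1
  set t2 : (Fin 4 → ℕ) → ℤ := fun b => ⌈g₂ * (b 3 : ℝ)⌉ + b 2 with ht2
  set s : (Fin 4 → ℕ) → ℝ := fun b => -(m 1 * t1 b + m 2 * t2 b + m 3 * (b 3 : ℝ)) / m 0 with hs
  set φ : (Fin 4 → ℕ) → (Fin 4 → ℤ) := fun b => ![⌈s b⌉ + b 0, t1 b, t2 b, b 3] with hφ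
  have hfl : ∀ i (b : ℕ), b < ⌊a i⌋₊ → (b : ℝ) + 1 ≤ a i := by
    intro i b hb
    have h1 : ((b + 1 : ℕ) : ℝ) ≤ ⌊a i⌋₊ := by exact_mod_cast hb
    push_cast at h1
    exact h1.trans (Nat.floor_le (by linarith [ha i]))
  refine ⟨(Fintype.piFinset fun i => range ⌊a i⌋₊).image φ, ?_, ?_⟩
  · intro t ht
    obtain ⟨b, hb, rfl⟩ := mem_image.mp ht
    have hb' : ∀ i, (b i : ℝ) + 1 ≤ a i := fun i =>
      hfl i _ (mem_range.mp (Fintype.mem_piFinset.mp hb i))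
    have hpos : ∀ i, (0 : ℝ) ≤ b i := fun i => Nat.cast_nonneg _
    have e0 : φ b 0 = ⌈s b⌉ + b 0 := rfl
    have e1 : φ b 1 = t1 b := rfl
    have e2 : φ b 2 = t2 b := rfl
    have e3 : φ b 3 = b 3 := rfl
    have hsum : ∑ i, m i * (φ b i : ℝ) = m 0 * ((⌈s b⌉ : ℝ) + b 0 - s b) := by
      rw [Fin.sum_univ_four, e0, e1, e2, e3]
      have : m 0 * s b = -(m 1 * t1 b + m 2 * t2 b + m 3 * (b 3 : ℝ)) := by
        simp only [hs]; field_simp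
      push_cast
      generalize s b = w at this ⊢
      linear_combination this
    rw [hsum, e1, e2, e3]
    simp only [ht1, ht2]
    push_cast
    have c1 := Int.le_ceil (g₁ * (b 3 : ℝ))
    have c1' := Int.ceil_lt_add_one (g₁ * (b 3 : ℝ))
    have c2 := Int.le_ceil (g₂ * (b 3 : ℝ))
    have c2' := Int.ceil_lt_add_one (g₂ * (b 3 : ℝ))
    have c0 := Int.le_ceil (s b)
    have c0' := Int.ceil_lt_add_one (s b)
    refine ⟨⟨hpos 3, by linarith [hb' 3]⟩, ⟨by linarith [hpos 1], by linarith [hb' 1]⟩,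
      ⟨by linarith [hpos 2], by linarith [hb' 2]⟩, ?_, ?_⟩
    · exact mul_nonneg hm.le (by linarith [hpos 0])
    · exact mul_le_mul_of_nonneg_left (by linarith [hb' 0]) hm.le
  · rw [card_image_of_injective]
    · rw [Fintype.card_piFinset]
      simp only [card_range]
      push_cast
      have h : ∀ i, a i / 2 ≤ ⌊a i⌋₊ := by
        intro i
        have h1 := Nat.lt_floor_add_one (a i)
        have h2 : (1 : ℝ) ≤ ⌊a i⌋₊ := by
          exact_mod_cast (Nat.one_le_floor_iff _).mpr (ha i)
        linarith
      calc (∏ i, a i) / 16 = ∏ i, a i / 2 := by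
            rw [prod_div_distrib]; norm_num
        _ ≤ _ := prod_le_prod (fun i _ => by linarith [ha i]) fun i _ => h i
    · intro b b' h
      have e3 : (b 3 : ℤ) = b' 3 := congrFun h 3
      have e3' : b 3 = b' 3 := by exact_mod_cast e3
      have e1 : t1 b = t1 b' := congrFun h 1
      have e2 : t2 b = t2 b' := congrFun h 2
      have hs' : s b = s b' := by simp only [hs, e1, e2, e3']
      have e0 : ⌈s b⌉ + (b 0 : ℤ) = ⌈s b'⌉ + b' 0 := congrFun h 0
      simp only [ht1, ht2, e3'] at e1 e2
      rw [hs'] at e0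
      funext i
      fin_cases i
      · simpa using e0
      · simpa using e1
      · simpa using e2
      · exact e3'

/-- The form `n₀ ^ α + n₁ ^ α - n₂ ^ α - n₃ ^ α`. -/
noncomputable def quadForm (α : ℝ) (n : Fin 4 → ℤ) : ℝ := ∑ i, quadSign i * (n i : ℝ) ^ α

open Classical in
/-- Integer points of size comparable to `Q` at which `quadForm α` is at most `ρ * Q ^ α`. -/
noncomputable def nearSol (α lam ρ Q : ℝ) : Finset (Fin 4 → ℤ) :=
  (Fintype.piFinset fun _ => Icc 1 ⌊lam * Q⌋).filter fun n =>
    (∀ i, Q / lam ≤ n i) ∧ |quadForm α n| ≤ ρ * Q ^ α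

lemma mem_nearSol {α lam ρ Q : ℝ} (hlam : 0 < lam) (hQ : 0 < Q) {n : Fin 4 → ℤ} :
    n ∈ nearSol α lam ρ Q ↔
      (∀ i, Q / lam ≤ n i ∧ (n i : ℝ) ≤ lam * Q) ∧ |quadForm α n| ≤ ρ * Q ^ α := by
  simp only [nearSol, mem_filter, Fintype.mem_piFinset, mem_Icc, Int.le_floor]
  constructor
  · rintro ⟨h1, h2, h3⟩
    exact ⟨fun i => ⟨h2 i, (h1 i).2⟩, h3⟩
  · rintro ⟨h1, h3⟩
    refine ⟨fun i => ⟨?_, (h1 i).2⟩, fun i => (h1 i).1, h3⟩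
    have : (0 : ℝ) < n i := lt_of_lt_of_le (by positivity) (h1 i).1
    have : 0 < n i := by exact_mod_cast this
    omega

lemma rpow_bounds_of_comparable {lam Q a : ℝ} (hlam : 1 ≤ lam) (hQ : 0 < Q)
    (h1 : Q / lam ≤ a) (h2 : a ≤ lam * Q) (β : ℝ) :
    a ^ β ≤ lam ^ |β| * Q ^ β ∧ Q ^ β ≤ lam ^ |β| * a ^ β := by
  have hl : 0 < lam := by linarith
  have ha : 0 < a := lt_of_lt_of_le (by positivity) h1
  have key : ∀ x y : ℝ, 0 < x → 0 < y → x ≤ lam * y → y ≤ lam * x →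
      x ^ β ≤ lam ^ |β| * y ^ β := by
    intro x y hx hy hxy hyx
    rcases le_total 0 β with h | h
    · rw [abs_of_nonneg h, ← Real.mul_rpow hl.le hy.le]
      exact Real.rpow_le_rpow hx.le hxy h
    · rw [abs_of_nonpos h]
      have := Real.rpow_le_rpow_of_nonpos hy hyx h
      rw [Real.mul_rpow hl.le hx.le] at this
      calc x ^ β = lam ^ (-β) * (lam ^ β * x ^ β) := by
            rw [← mul_assoc, ← Real.rpow_add hl]; simp
        _ ≤ _ := by gcongr
  have h3 : Q ≤ lam * a := by rwa [div_le_iff₀' hl] at h1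
  exact ⟨key a Q ha hQ h2 h3, key Q a hQ ha h3 h2⟩

lemma sum_quadSign_mul_rpow_ratio (α : ℝ) {m : Fin 4 → ℤ} {x : Fin 4 → ℝ} {n : Fin 4 → ℤ} {w : ℝ}
    (hm : ∀ i, 0 < (m i : ℝ)) (hx : ∀ i, 0 < x i) (hw : 0 < w)
    (h : ∀ i, (n i : ℝ) = w * (m i * x i)) :
    ∑ i, quadSign i * (m i : ℝ) ^ α * x i ^ α = w ^ (-α) * quadForm α n := by
  simp only [quadForm, mul_sum]
  refine sum_congr rfl fun i _ => ?_
  rw [h i, Real.mul_rpow hw.le (mul_pos (hm i) (hx i)).le, Real.mul_rpow (hm i).le (hx i).le,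
    Real.rpow_neg hw.le]
  have := (Real.rpow_pos_of_pos hw α).ne'
  field_simp

/-- Two solutions with nearly proportional first three coordinates are nearly proportional, and
the gradient at one of them is nearly orthogonal to the other. -/
lemma exists_gradient_bound (α lam κ : ℝ) (hα : α ≠ 0) (hlam : 1 ≤ lam) (hκ : 0 < κ) :
    ∃ C : ℝ, 0 < C ∧ ∀ (Q r : ℝ), 0 < Q → 0 < r → r ≤ 1 → ∀ m n : Fin 4 → ℤ,
      m ∈ nearSol α lam (κ * r ^ 2) Q → n ∈ nearSol α lam (κ * r ^ 2) Q →
      |(n 1 : ℝ) / n 0 - m 1 / m 0| ≤ r → |(n 2 : ℝ) / n 0 - m 2 / m 0| ≤ r →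
      |∑ i, quadSign i * (m i : ℝ) ^ (α - 1) * n i| ≤ C * Q ^ α * r ^ 2 := by
  have hl : 0 < lam := by linarith
  set Λ := lam ^ 4 with hΛ
  have hΛ1 : 1 ≤ Λ := one_le_pow₀ hlam
  have hΛ0 : 0 < Λ := by linarith
  set L := lam ^ |α| with hL
  have hL0 : 0 < L := Real.rpow_pos_of_pos hl _
  obtain ⟨C₁, hC₁, hC₁'⟩ := exists_rpow_lipschitz α Λ hΛ1
  obtain ⟨C₂, hC₂, hC₂'⟩ := exists_rpow_lipschitz (1 / α) (Λ ^ |α|)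
    (Real.one_le_rpow hΛ1 (abs_nonneg _))
  obtain ⟨C₃, hC₃, hC₃'⟩ := exists_linearization α Λ hΛ1
  set A := (lam ^ 2) ^ |α| with hA
  have hA0 : 0 < A := Real.rpow_pos_of_pos (by positivity) _
  set D := lam ^ 2 + C₂ * (L * (A * κ + κ + 2 * L * C₁ * lam ^ 2)) with hD
  have hD0 : 0 < D := by positivity
  set E := (A * κ + |1 - α| * κ + C₃ * L * D ^ 2) / |α| with hE
  have hαpos : 0 < |α| := abs_pos.mpr hα
  have hE0 : 0 < E := by positivity
  refine ⟨lam ^ 2 * E, by positivity, ?_⟩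
  intro Q r hQ hr hr1 m n hm hn h1 h2
  rw [mem_nearSol hl hQ] at hm hn
  obtain ⟨hmb, hmF⟩ := hm
  obtain ⟨hnb, hnF⟩ := hn
  have hm0 : ∀ i, 0 < (m i : ℝ) := fun i => lt_of_lt_of_le (by positivity) (hmb i).1
  have hn0 : ∀ i, 0 < (n i : ℝ) := fun i => lt_of_lt_of_le (by positivity) (hnb i).1
  have hQα : 0 < Q ^ α := Real.rpow_pos_of_pos hQ _
  have ratio : ∀ a b : ℝ, 0 < a → 0 < b → Q / lam ≤ a → b ≤ lam * Q → b / a ≤ lam ^ 2 := by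
    intro a b ha hb h1 h2
    rw [div_le_iff₀ hl] at h1
    rw [div_le_iff₀ ha]
    nlinarith
  set w : ℝ := n 0 / m 0 with hw
  have hw0 : 0 < w := div_pos (hn0 0) (hm0 0)
  have hw1 : w ≤ lam ^ 2 := ratio _ _ (hm0 0) (hn0 0) (hmb 0).1 (hnb 0).2
  have hw2 : w⁻¹ ≤ lam ^ 2 := by
    rw [hw, inv_div]; exact ratio _ _ (hn0 0) (hm0 0) (hnb 0).1 (hmb 0).2
  set x : Fin 4 → ℝ := fun i => n i / m i / w with hx
  have hx0 : ∀ i, 0 < x i := fun i => div_pos (div_pos (hn0 i) (hm0 i)) hw0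
  have hnx : ∀ i, (n i : ℝ) = w * (m i * x i) := by
    intro i
    have := (hm0 i).ne'
    have := hw0.ne'
    simp only [hx]
    field_simp
  have hxb : ∀ i, 1 / Λ ≤ x i ∧ x i ≤ Λ := by
    intro i
    have e1 := ratio _ _ (hm0 i) (hn0 i) (hmb i).1 (hnb i).2
    have e2 := ratio _ _ (hn0 i) (hm0 i) (hnb i).1 (hmb i).2
    have e3 : x i = (n i / m i) * w⁻¹ := div_eq_mul_inv _ _
    have e4 : (x i)⁻¹ = (m i / n i) * w := by rw [e3, mul_inv, inv_inv, inv_div]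
    have e5 : Λ = lam ^ 2 * lam ^ 2 := by rw [hΛ]; ring
    constructor
    · rw [one_div, inv_le_comm₀ hΛ0 (hx0 i), e4, e5]
      exact mul_le_mul e2 hw1 hw0.le (by positivity)
    · rw [e3, e5]
      exact mul_le_mul e1 hw2 (by positivity) (by positivity)
  have hx00 : x 0 = 1 := by
    simp only [hx]; exact div_self hw0.ne'
  have hp : ∀ i, |(m i : ℝ) ^ α| ≤ L * Q ^ α := fun i => by
    rw [abs_of_pos (Real.rpow_pos_of_pos (hm0 i) _)]
    exact (rpow_bounds_of_comparable hlam hQ (hmb i).1 (hmb i).2 α).1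
  have hxi : ∀ i, |(n i : ℝ) / n 0 - m i / m 0| ≤ r → |x i - 1| ≤ lam ^ 2 * r := by
    intro i hi
    have : x i - 1 = (m 0 / m i) * ((n i : ℝ) / n 0 - m i / m 0) := by
      have := (hm0 i).ne'
      have := (hm0 0).ne'
      have := (hn0 0).ne'
      simp only [hx, hw]
      field_simp
    rw [this, abs_mul, abs_of_pos (div_pos (hm0 0) (hm0 i))]
    exact mul_le_mul (ratio _ _ (hm0 i) (hm0 0) (hmb i).1 (hmb 0).2) hi (abs_nonneg _)
      (by positivity)
  have hsum : ∑ i, quadSign i * (m i : ℝ) ^ α * x i ^ α = w ^ (-α) * quadForm α n :=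
    sum_quadSign_mul_rpow_ratio α hm0 hx0 hw0 hnx
  have hwα : w ^ (-α) ≤ A := by
    have := (rpow_bounds_of_comparable (lam := lam ^ 2) (Q := 1) (a := w) (one_le_pow₀ hlam)
      one_pos (by rw [one_div, inv_le_comm₀ (by positivity) hw0]; exact hw2)
      (by simpa using hw1) (-α)).1
    simpa [hA] using this
  have hwF : |w ^ (-α) * quadForm α n| ≤ A * κ * (Q ^ α * r ^ 2) := by
    rw [abs_mul, abs_of_pos (Real.rpow_pos_of_pos hw0 _)]
    calc _ ≤ A * (κ * r ^ 2 * Q ^ α) := mul_le_mul hwα hnF (abs_nonneg _) hA0.le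
      _ = _ := by ring
  have hmF' : |quadForm α m| ≤ κ * (Q ^ α * r ^ 2) := hmF.trans (le_of_eq (by ring))
  have hd : ∀ i, |x i - 1| ≤ D * r := by
    have hbig : lam ^ 2 * r ≤ D * r := by
      refine mul_le_mul_of_nonneg_right ?_ hr.le
      rw [hD]; exact le_add_of_nonneg_right (by positivity)
    have hα1 : ∀ i, |x i - 1| ≤ lam ^ 2 * r → |x i ^ α - 1| ≤ C₁ * (lam ^ 2 * r) := fun i hi =>
      (hC₁' _ (hxb i).1 (hxb i).2).trans (mul_le_mul_of_nonneg_left hi hC₁.le)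
    have h3 : |x 3 ^ α - 1| ≤ L * (A * κ + κ + 2 * L * C₁ * lam ^ 2) * r := by
      have e1 : (m 3 : ℝ) ^ α * (x 3 ^ α - 1) =
          quadForm α m - w ^ (-α) * quadForm α n + (m 1 : ℝ) ^ α * (x 1 ^ α - 1) -
            (m 2 : ℝ) ^ α * (x 2 ^ α - 1) := by
        rw [← hsum]
        simp only [quadForm, Fin.sum_univ_four, hx00]
        simp [quadSign]
        ring
      have hr2 : r ^ 2 ≤ r := by nlinarith
      have t1 : |quadForm α m| ≤ κ * (Q ^ α * r) := hmF'.trans (by gcongr)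
      have t2 : |w ^ (-α) * quadForm α n| ≤ A * κ * (Q ^ α * r) := hwF.trans (by gcongr)
      have t3 : ∀ i, |x i - 1| ≤ lam ^ 2 * r →
          |(m i : ℝ) ^ α * (x i ^ α - 1)| ≤ L * Q ^ α * (C₁ * (lam ^ 2 * r)) := fun i hi => by
        rw [abs_mul]
        exact mul_le_mul (hp i) (hα1 i hi) (abs_nonneg _) (by positivity)
      have t4 := t3 1 (hxi 1 h1)
      have t5 := t3 2 (hxi 2 h2)
      have t6 : |(m 3 : ℝ) ^ α * (x 3 ^ α - 1)| ≤
          Q ^ α * ((A * κ + κ + 2 * L * C₁ * lam ^ 2) * r) := by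
        rw [e1, abs_le]
        rw [abs_le] at t1 t2 t4 t5
        constructor <;> linarith [t1.1, t1.2, t2.1, t2.2, t4.1, t4.2, t5.1, t5.2]
      have t7 := (rpow_bounds_of_comparable hlam hQ (hmb 3).1 (hmb 3).2 α).2
      rw [abs_mul, abs_of_pos (Real.rpow_pos_of_pos (hm0 3) _)] at t6
      have hp3 := Real.rpow_pos_of_pos (hm0 3) α
      refine le_of_mul_le_mul_left (t6.trans ?_) hp3
      calc _ ≤ L * (m 3 : ℝ) ^ α * ((A * κ + κ + 2 * L * C₁ * lam ^ 2) * r) := by gcongr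
        _ = _ := by ring
    have h4 : |x 3 - 1| ≤ C₂ * |x 3 ^ α - 1| := by
      have hb := rpow_bounds_of_comparable (lam := Λ) (Q := 1) hΛ1 one_pos (hxb 3).1
        (by simpa using (hxb 3).2) α
      simp only [Real.one_rpow, mul_one] at hb
      have hΛα : 0 < Λ ^ |α| := Real.rpow_pos_of_pos hΛ0 _
      have := hC₂' (x 3 ^ α) (by rw [div_le_iff₀' hΛα]; exact hb.2) hb.1
      rwa [← Real.rpow_mul (hx0 3).le, mul_one_div_cancel hα, Real.rpow_one] at this
    intro i
    fin_cases i
    · simp only [Fin.zero_eta, hx00, sub_self, abs_zero]; positivity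
    · exact (hxi 1 h1).trans hbig
    · exact (hxi 2 h2).trans hbig
    · refine h4.trans ((mul_le_mul_of_nonneg_left h3 hC₂.le).trans ?_)
      rw [hD, ← mul_assoc]
      refine mul_le_mul_of_nonneg_right ?_ hr.le
      exact le_add_of_nonneg_left (by positivity)
  have hlin := hC₃' (fun i => (m i : ℝ) ^ α) x (L * Q ^ α) (D * r) hp hxb hd
  rw [hsum] at hlin
  change |_ - α * _| ≤ |1 - α| * |quadForm α m| + _ at hlin
  set S := ∑ i, quadSign i * (m i : ℝ) ^ α * x i with hS
  have hSb : |S| ≤ E * (Q ^ α * r ^ 2) := by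
    have e1 : |α * S| ≤ (A * κ + |1 - α| * κ + C₃ * L * D ^ 2) * (Q ^ α * r ^ 2) := by
      have e2 : |1 - α| * |quadForm α m| ≤ |1 - α| * (κ * (Q ^ α * r ^ 2)) := by gcongr
      have e3 := abs_sub_abs_le_abs_sub (α * S) (w ^ (-α) * quadForm α n)
      rw [abs_sub_comm] at e3
      have e4 : C₃ * (L * Q ^ α) * (D * r) ^ 2 = C₃ * L * D ^ 2 * (Q ^ α * r ^ 2) := by ring
      rw [e4] at hlin
      linarith
    rw [abs_mul] at e1
    rw [hE, div_mul_eq_mul_div, le_div_iff₀ hαpos, mul_comm]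
    exact e1
  have hfin : ∑ i, quadSign i * (m i : ℝ) ^ (α - 1) * n i = w * S := by
    rw [hS, mul_sum]
    refine sum_congr rfl fun i _ => ?_
    rw [hnx i, Real.rpow_sub_one (hm0 i).ne']
    have := (hm0 i).ne'
    field_simp
  rw [hfin, abs_mul, abs_of_pos hw0]
  calc w * |S| ≤ lam ^ 2 * (E * (Q ^ α * r ^ 2)) :=
        mul_le_mul hw1 hSb (abs_nonneg _) (by positivity)
    _ = _ := by ring

/-- A neighbourhood of the line spanned by the gradient of `quadForm α` at `m`. -/
def DualBox (α c J r : ℝ) (m k : Fin 4 → ℤ) : Prop :=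
  |(k 3 : ℝ)| ≤ c * J ∧
    |k 1 - quadSign 1 * quadSign 3 * ((m 1 : ℝ) / m 3) ^ (α - 1) * k 3| ≤ c * (J * r) ∧
    |k 2 - quadSign 2 * quadSign 3 * ((m 2 : ℝ) / m 3) ^ (α - 1) * k 3| ≤ c * (J * r) ∧
    |∑ i, (m i : ℝ) * k i| ≤ c

/-- The number of solutions in a narrow cone is controlled by the number of integer points in the
dual box. -/
lemma exists_card_le_dualBox (α lam κ : ℝ) (hα : α ≠ 0) (hlam : 1 ≤ lam) (hκ : 0 < κ) :
    ∃ c₁ : ℝ, 0 < c₁ ∧ ∀ c : ℝ, 0 < c → c ≤ c₁ → ∀ Q r J : ℝ, 0 < Q → 0 < J → 0 < r → r ≤ 1 →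
      J * Q * r ^ 2 = 1 → ∀ m ∈ nearSol α lam (κ * r ^ 2) Q,
      ∀ F ⊆ nearSol α lam (κ * r ^ 2) Q,
      (∀ n ∈ F, |(n 1 : ℝ) / n 0 - m 1 / m 0| ≤ r ∧ |(n 2 : ℝ) / n 0 - m 2 / m 0| ≤ r) →
      ∃ K : Finset (Fin 4 → ℤ), (∀ k ∈ K, DualBox α c J r m k) ∧
        (#F : ℝ) ≤ 64 * lam / c ^ 4 * (Q / J) ^ 2 * #K := by
  have hl : 0 < lam := by linarith
  obtain ⟨C, hC0, hC⟩ := exists_gradient_bound α lam κ hα hlam hκ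
  set L := lam ^ |α - 1| with hL
  have hL0 : 0 < L := Real.rpow_pos_of_pos hl _
  set M := L * C + lam ^ 2 * (1 + L * κ + 2 * lam ^ 3) with hM
  have hM0 : 0 < M := by positivity
  refine ⟨1 / (6 * M), by positivity, ?_⟩
  intro c hc hc₁ Q r J hQ hJ hr hr1 hJQ m hm F hF hFr
  have hcM : c * M ≤ 1 / 6 := by
    rw [le_div_iff₀ (by positivity)] at hc₁
    linarith
  have hm' := hm
  rw [mem_nearSol hl hQ] at hm
  obtain ⟨hmb, hmF⟩ := hm
  have hm0 : ∀ i, 0 < (m i : ℝ) := fun i => lt_of_lt_of_le (by positivity) (hmb i).1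
  have hmQ : ∀ i, (m i : ℝ) / (lam * Q) ≤ 1 := fun i =>
    (div_le_one (by positivity)).mpr (hmb i).2
  obtain ⟨R, hR⟩ := exists_nat_ge (1 / (c * J) + 1 / (c * (J * r)) + lam * Q / c + lam * Q + 1)
  have q1 : 0 < 1 / (c * J) := by positivity
  have q2 : 0 < 1 / (c * (J * r)) := by positivity
  have q3 : 0 < lam * Q / c := by positivity
  have q4 : 0 < lam * Q := by positivity
  have hR0 : (0 : ℝ) < R := by linarith
  have : NeZero R := ⟨by rintro rfl; simp at hR0⟩
  have hRa : 1 ≤ c * J * R := by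
    rw [← div_le_iff₀' (by positivity)]; linarith
  have hRb : 1 ≤ c * (J * r) * R := by
    rw [← div_le_iff₀' (by positivity)]; linarith
  have hRc : 1 ≤ c / (lam * Q) * R := by
    rw [← div_le_iff₀' (by positivity), one_div_div]; linarith
  set g : Fin 4 → ℝ := fun i => quadSign i * quadSign 3 * ((m i : ℝ) / m 3) ^ (α - 1) with hg
  obtain ⟨T, hT, hTcard⟩ := exists_skew_box (fun i => (m i : ℝ)) (hm0 0) (g 1) (g 2)
    ![c / (lam * Q) * R, c * (J * r) * R, c * (J * r) * R, c * J * R]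
    (by intro i; fin_cases i <;> assumption)
  simp only [Fin.prod_univ_four, Matrix.cons_val] at hTcard hT
  have hmA : (m 0 : ℝ) * (c / (lam * Q) * R) ≤ c * R := by
    calc _ = (m 0 : ℝ) / (lam * Q) * (c * R) := by ring
      _ ≤ 1 * (c * R) := by gcongr; exact hmQ 0
      _ = _ := one_mul _
  have hdot : ∀ n ∈ F, ∀ t ∈ T, |((∑ i, n i * t i : ℤ) : ℝ)| ≤ R / 6 := by
    intro n hnF t ht
    have hn' := hF hnF
    have hgrad := hC Q r hQ hr hr1 m n hm' hn' (hFr n hnF).1 (hFr n hnF).2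
    obtain ⟨hn1, hn2⟩ := hFr n hnF
    rw [mem_nearSol hl hQ] at hn'
    obtain ⟨hnb, -⟩ := hn'
    have hn0 : ∀ i, 0 < (n i : ℝ) := fun i => lt_of_lt_of_le (by positivity) (hnb i).1
    obtain ⟨⟨b3, b3'⟩, ⟨b1, b1'⟩, ⟨b2, b2'⟩, ⟨b0, b0'⟩⟩ := hT t ht
    set u : ℝ := t 3 / (quadSign 3 * (m 3 : ℝ) ^ (α - 1)) with hu
    set w : ℝ := n 0 / m 0 with hw
    have hw1 : w ≤ lam ^ 2 := by
      have h1 := (hmb 0).1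
      have h2 := (hnb 0).2
      rw [div_le_iff₀ hl] at h1
      rw [hw, div_le_iff₀ (hm0 0)]
      nlinarith
    have hw0 : 0 < w := div_pos (hn0 0) (hm0 0)
    have hq3 : quadSign 3 ≠ 0 := by simp [quadSign]
    have hp3 := Real.rpow_pos_of_pos (hm0 3) (α - 1)
    have hgu : ∀ i, g i * t 3 = u * (quadSign i * (m i : ℝ) ^ (α - 1)) := by
      intro i
      have := quadSign_mul_self 3
      simp only [hg, hu, Real.div_rpow (hm0 i).le (hm0 3).le]
      field_simp
      linear_combination (quadSign i * (m i : ℝ) ^ (α - 1) * t 3) * this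
    have hg3 : g 3 = 1 := by
      simp only [hg, quadSign_mul_self, div_self (hm0 3).ne', Real.one_rpow, mul_one]
    have hgF : ∑ i, (m i : ℝ) * (g i * t 3) = u * quadForm α m := by
      simp only [hgu, quadForm, mul_sum]
      refine sum_congr rfl fun i _ => ?_
      rw [Real.rpow_sub_one (hm0 i).ne']
      have := (hm0 i).ne'
      field_simp
    have hident : ((∑ i, n i * t i : ℤ) : ℝ) =
        u * ∑ i, quadSign i * (m i : ℝ) ^ (α - 1) * n i +
          w * (∑ i, (m i : ℝ) * t i - u * quadForm α m) +
          (t 1 - g 1 * t 3) * (n 1 - w * m 1) + (t 2 - g 2 * t 3) * (n 2 - w * m 2) := by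
      rw [← hgF]
      have h1 : u * ∑ i, quadSign i * (m i : ℝ) ^ (α - 1) * n i =
          ∑ i, (g i * t 3) * n i := by
        rw [mul_sum]
        refine sum_congr rfl fun i _ => ?_
        rw [hgu]; ring
      rw [h1]
      push_cast
      simp only [Fin.sum_univ_four, hg3]
      have h2 : w * m 0 = n 0 := div_mul_cancel₀ _ (hm0 0).ne'
      linear_combination (-(t 0 : ℝ) + g 0 * t 3) * h2
    have hu1 : |u| ≤ c * J * R * (L * (Q ^ α / Q)⁻¹) := by
      rw [hu, abs_div, abs_mul, abs_quadSign, one_mul, abs_of_nonneg b3, abs_of_pos hp3,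
        div_eq_mul_inv]
      refine mul_le_mul b3' ?_ (by positivity) (by positivity)
      rw [← Real.rpow_sub_one hQ.ne', ← div_eq_mul_inv, inv_eq_one_div, div_le_div_iff₀ hp3
        (Real.rpow_pos_of_pos hQ _), one_mul]
      exact (rpow_bounds_of_comparable hlam hQ (hmb 3).1 (hmb 3).2 (α - 1)).2
    have hQα : 0 < Q ^ α := Real.rpow_pos_of_pos hQ _
    have hT1 : |u * ∑ i, quadSign i * (m i : ℝ) ^ (α - 1) * n i| ≤ c * (L * C) * R := by
      rw [abs_mul]
      refine (mul_le_mul hu1 hgrad (abs_nonneg _) (by positivity)).trans (le_of_eq ?_)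
      field_simp
      linear_combination hJQ
    have hT2 : |u * quadForm α m| ≤ c * (L * κ) * R := by
      rw [abs_mul]
      refine (mul_le_mul hu1 hmF (abs_nonneg _) (by positivity)).trans (le_of_eq ?_)
      field_simp
      linear_combination hJQ
    have hT3 : |∑ i, (m i : ℝ) * t i| ≤ c * R := by
      rw [abs_of_nonneg b0]; exact b0'.trans hmA
    have hT4 : |w * (∑ i, (m i : ℝ) * t i - u * quadForm α m)| ≤
        lam ^ 2 * (c * R + c * (L * κ) * R) := by
      rw [abs_mul, abs_of_pos hw0]
      exact mul_le_mul hw1 ((abs_sub _ _).trans (add_le_add hT3 hT2)) (abs_nonneg _)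
        (by positivity)
    have hv : ∀ i, |(n i : ℝ) / n 0 - m i / m 0| ≤ r → |(n i : ℝ) - w * m i| ≤ lam * Q * r := by
      intro i hi
      have : (n i : ℝ) - w * m i = n 0 * ((n i : ℝ) / n 0 - m i / m 0) := by
        have := (hn0 0).ne'
        have := (hm0 0).ne'
        rw [hw]; field_simp
      rw [this, abs_mul, abs_of_pos (hn0 0)]
      exact mul_le_mul (hnb 0).2 hi (abs_nonneg _) q4.le
    have hT5 : ∀ i, |(n i : ℝ) / n 0 - m i / m 0| ≤ r → 0 ≤ t i - g i * t 3 →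
        t i - g i * t 3 ≤ c * (J * r) * R →
        |(t i - g i * t 3) * (n i - w * m i)| ≤ c * lam ^ 5 * R := by
      intro i hi h1 h2
      rw [abs_mul, abs_of_nonneg h1]
      refine (mul_le_mul h2 (hv i hi) (abs_nonneg _) (by positivity)).trans ?_
      calc c * (J * r) * R * (lam * Q * r) = c * lam * R * (J * Q * r ^ 2) := by ring
        _ = c * R * lam ^ 1 := by rw [hJQ]; ring
        _ ≤ c * R * lam ^ 5 := by
          exact mul_le_mul_of_nonneg_left (pow_le_pow_right₀ hlam (by norm_num)) (by positivity)
        _ = _ := by ring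
    rw [hident]
    calc _ ≤ c * (L * C) * R + lam ^ 2 * (c * R + c * (L * κ) * R) + c * lam ^ 5 * R +
          c * lam ^ 5 * R :=
          (abs_add_le _ _).trans (add_le_add ((abs_add_le _ _).trans (add_le_add
            ((abs_add_le _ _).trans (add_le_add hT1 hT4)) (hT5 1 hn1 b1 b1'))) (hT5 2 hn2 b2 b2'))
      _ = (c * M) * R := by rw [hM]; ring
      _ ≤ 1 / 6 * R := by gcongr
      _ = R / 6 := by ring
  obtain ⟨K, hK, hKcard⟩ := exists_card_mul_card_le R F T
    (fun n hn n' hn' h => by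
      have hn2 := hF hn
      have hn2' := hF hn'
      rw [mem_nearSol hl hQ] at hn2 hn2'
      funext i
      have h1 : (R : ℤ) ∣ n i - n' i := by
        rw [← ZMod.intCast_zmod_eq_zero_iff_dvd]
        push_cast
        rw [h i, sub_self]
      have h2 : |((n i - n' i : ℤ) : ℝ)| < R := by
        have a1 := hn2.1 i
        have a2 := hn2'.1 i
        have a3 : 0 < Q / lam := by positivity
        push_cast
        rw [abs_lt]
        constructor <;> linarith
      have h3 : |n i - n' i| < R := by exact_mod_cast h2
      have := Int.eq_zero_of_abs_lt_dvd h1 h3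
      omega) hdot
  refine ⟨K, ?_, ?_⟩
  · intro k hk
    obtain ⟨t, ht, t', ht', htk⟩ := hK k hk
    obtain ⟨⟨b3, b3'⟩, ⟨b1, b1'⟩, ⟨b2, b2'⟩, ⟨b0, b0'⟩⟩ := hT t ht
    obtain ⟨⟨d3, d3'⟩, ⟨d1, d1'⟩, ⟨d2, d2'⟩, ⟨d0, d0'⟩⟩ := hT t' ht'
    have htk' : ∀ i, (R : ℝ) * k i = t i - t' i := fun i => by exact_mod_cast (htk i).symm
    have habs : ∀ z B : ℝ, |R * z| ≤ B * R → |z| ≤ B := by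
      intro z B h
      rw [abs_mul, abs_of_pos hR0, mul_comm B] at h
      exact le_of_mul_le_mul_left h hR0
    refine ⟨habs _ _ ?_, habs _ _ ?_, habs _ _ ?_, habs _ _ ?_⟩
    · rw [htk', abs_le]; constructor <;> linarith
    · rw [mul_sub, mul_left_comm, htk', htk', abs_le]
      change _ ≤ _ - g 1 * _ ∧ _ - g 1 * _ ≤ _
      constructor <;> linarith
    · rw [mul_sub, mul_left_comm, htk', htk', abs_le]
      change _ ≤ _ - g 2 * _ ∧ _ - g 2 * _ ≤ _
      constructor <;> linarith
    · have : (R : ℝ) * ∑ i, (m i : ℝ) * k i =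
          ∑ i, (m i : ℝ) * t i - ∑ i, (m i : ℝ) * t' i := by
        rw [mul_sum, ← sum_sub_distrib]
        refine sum_congr rfl fun i _ => ?_
        linear_combination (m i : ℝ) * htk' i
      rw [this, abs_le]
      constructor <;> linarith
  · have hprod : c / (lam * Q) * R * (c * (J * r) * R) * (c * (J * r) * R) * (c * J * R) / 16 =
        c ^ 4 / (16 * lam) * (J / Q) ^ 2 * (R : ℝ) ^ 4 := by
      field_simp
      linear_combination hJQ
    rw [hprod] at hTcard
    have h1 : (#F : ℝ) * (c ^ 4 / (16 * lam) * (J / Q) ^ 2 * (R : ℝ) ^ 4) ≤ 4 * R ^ 4 * #K :=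
      (mul_le_mul_of_nonneg_left hTcard (Nat.cast_nonneg _)).trans hKcard
    have h2 : (0 : ℝ) < c ^ 4 / (16 * lam) * (J / Q) ^ 2 * (R : ℝ) ^ 4 := by positivity
    refine le_of_mul_le_mul_right (h1.trans (le_of_eq ?_)) h2
    field_simp
    ring

set_option maxHeartbeats 1000000 in
/-- Nonzero integer points in a dual box are near-solutions for the conjugate exponent, and they
determine the direction of the base point. -/
lemma exists_dualBox_bounds (α lam κ : ℝ) (hα1 : α ≠ 1) (hlam : 1 ≤ lam) (hκ : 0 < κ) :
    ∃ c₂ : ℝ, 0 < c₂ ∧ ∃ Λ : ℝ, 1 ≤ Λ ∧ ∃ κ' : ℝ, 0 < κ' ∧ ∃ D : ℝ, 0 < D ∧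
      ∀ c : ℝ, 0 < c → c ≤ c₂ → ∀ Q r J : ℝ, 0 < Q → 0 < J → 0 < r → r ≤ 1 → J * r ≤ 1 →
      J * Q * r ^ 2 = 1 → ∀ m ∈ nearSol α lam (κ * r ^ 2) Q, ∀ k : Fin 4 → ℤ,
      DualBox α c J r m k → k ≠ 0 →
      (1 ≤ |k 3| ∧ |(k 3 : ℝ)| ≤ J) ∧
      (∀ i, |(k 3 : ℝ)| / Λ ≤ |(k i : ℝ)| ∧ |(k i : ℝ)| ≤ Λ * |(k 3 : ℝ)|) ∧
      |quadForm (α / (α - 1)) (fun i => |k i|)| ≤ κ' * |(k 3 : ℝ)| ^ (α / (α - 1) - 2) ∧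
      |(m 1 : ℝ) / m 0 - (|(k 1 : ℝ)| / |(k 0 : ℝ)|) ^ (1 / (α - 1))| ≤ D * (J * r / |(k 3 : ℝ)|) ∧
      |(m 2 : ℝ) / m 0 - (|(k 2 : ℝ)| / |(k 0 : ℝ)|) ^ (1 / (α - 1))| ≤
        D * (J * r / |(k 3 : ℝ)|) := by
  have hl : 0 < lam := by linarith
  have hα1' : α - 1 ≠ 0 := sub_ne_zero.mpr hα1
  set α' := α / (α - 1) with hα'
  set L := lam ^ |α - 1| with hL
  have hL0 : 0 < L := Real.rpow_pos_of_pos hl _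
  set L' := lam ^ |α| with hL'
  have hL0' : 0 < L' := Real.rpow_pos_of_pos hl _
  set G := (lam ^ 2) ^ |α - 1| with hG
  have hG1 : 1 ≤ G := Real.one_le_rpow (one_le_pow₀ hlam) (abs_nonneg _)
  have hG0 : 0 < G := by linarith
  set V := lam + lam * (L * κ) + 2 * lam ^ 2 with hV
  have hV0 : 0 < V := by positivity
  have hV1 : 1 ≤ V := by
    have : 0 ≤ lam * (L * κ) + 2 * lam ^ 2 := by positivity
    linarith
  obtain ⟨C₁, hC₁, hC₁'⟩ := exists_rpow_lipschitz (1 / (α - 1)) 3 (by norm_num)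
  obtain ⟨C₃, hC₃, hC₃'⟩ := exists_linearization α' 2 (by norm_num)
  refine ⟨1 / (2 * V * G), by positivity, 2 * G, by linarith,
    L' * (|α'| * L + |1 - α'| * κ + C₃ * L' * (V * G) ^ 2), by positivity,
    lam ^ 2 * (C₁ * (4 * (V * G))), by positivity, ?_⟩
  intro c hc hc₂ Q r J hQ hJ hr hr1 hJr hJQ m hm k hk hk0
  have hcVG : c * V * G ≤ 1 / 2 := by
    rw [le_div_iff₀ (by positivity)] at hc₂
    linarith
  have hVG1 : 1 ≤ V * G := one_le_mul_of_one_le_of_one_le hV1 hG1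
  have hc1 : c ≤ 1 := by
    have := le_mul_of_one_le_right hc.le hVG1
    linarith
  rw [mem_nearSol hl hQ] at hm
  obtain ⟨hmb, hmF⟩ := hm
  have hm0 : ∀ i, 0 < (m i : ℝ) := fun i => lt_of_lt_of_le (by positivity) (hmb i).1
  have ratio : ∀ i j, (m i : ℝ) / m j ≤ lam ^ 2 := by
    intro i j
    have h1 := (hmb j).1
    have h2 := (hmb i).2
    rw [div_le_iff₀ hl] at h1
    rw [div_le_iff₀ (hm0 j)]
    nlinarith
  set s := J * r with hs
  have hs0 : 0 < s := by positivity
  obtain ⟨hk3, hk1, hk2, hkm⟩ := hk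
  set γ : Fin 4 → ℝ := fun i => ((m i : ℝ) / m 3) ^ (α - 1) with hγ
  have hγ0 : ∀ i, 0 < γ i := fun i => Real.rpow_pos_of_pos (div_pos (hm0 i) (hm0 3)) _
  have hγb : ∀ i, 1 / G ≤ γ i ∧ γ i ≤ G := by
    intro i
    have h1 : (1 : ℝ) / lam ^ 2 ≤ m i / m 3 := by
      rw [div_le_iff₀ (by positivity), ← div_le_iff₀' (div_pos (hm0 i) (hm0 3)), one_div_div]
      exact ratio 3 i
    have := rpow_bounds_of_comparable (lam := lam ^ 2) (Q := 1) (one_le_pow₀ hlam) one_pos h1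
      (by simpa using ratio i 3) (α - 1)
    simp only [Real.one_rpow, mul_one] at this
    exact ⟨by rw [div_le_iff₀' hG0]; exact this.2, this.1⟩
  have hγ3 : γ 3 = 1 := by simp only [hγ, div_self (hm0 3).ne', Real.one_rpow]
  set g : Fin 4 → ℝ := fun i => quadSign i * quadSign 3 * γ i with hg
  have hg3 : g 3 = 1 := by simp only [hg, quadSign_mul_self, hγ3, mul_one]
  have hgabs : ∀ i, |g i| = γ i := fun i => by
    simp only [hg, abs_mul, abs_quadSign, one_mul, abs_of_pos (hγ0 i)]
  have hg0 : ∀ i, g i ≠ 0 := fun i => abs_pos.mp (by rw [hgabs]; exact hγ0 i)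
  have hp3 := Real.rpow_pos_of_pos (hm0 3) (α - 1)
  have hgF : ∑ i, (m i : ℝ) * (g i * k 3) =
      k 3 * quadSign 3 / (m 3 : ℝ) ^ (α - 1) * quadForm α m := by
    simp only [quadForm, mul_sum]
    refine sum_congr rfl fun i _ => ?_
    simp only [hg, hγ, Real.div_rpow (hm0 i).le (hm0 3).le]
    rw [Real.rpow_sub_one (hm0 i).ne']
    have := (hm0 i).ne'
    field_simp
  have hQα : 0 < Q ^ α := Real.rpow_pos_of_pos hQ _
  have hgFb : |∑ i, (m i : ℝ) * (g i * k 3)| ≤ c * (L * κ) := by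
    rw [hgF, abs_mul, abs_div, abs_mul, abs_quadSign, mul_one, abs_of_pos hp3]
    have h1 := (rpow_bounds_of_comparable hlam hQ (hmb 3).1 (hmb 3).2 (α - 1)).2
    rw [Real.rpow_sub_one hQ.ne'] at h1
    have h2 : |(k 3 : ℝ)| / (m 3 : ℝ) ^ (α - 1) ≤ c * J * (L * (Q ^ α / Q)⁻¹) := by
      rw [div_eq_mul_inv]
      refine mul_le_mul hk3 ?_ (by positivity) (by positivity)
      rw [← div_eq_mul_inv, inv_eq_one_div, div_le_div_iff₀ hp3 (by positivity), one_mul]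
      exact h1
    refine (mul_le_mul h2 hmF (abs_nonneg _) (by positivity)).trans (le_of_eq ?_)
    field_simp
    linear_combination hJQ
  set v : Fin 4 → ℝ := fun i => k i - g i * k 3 with hv
  have hv3 : v 3 = 0 := by simp only [hv, hg3, one_mul, sub_self]
  have hv0 : |v 0| ≤ c * V * s := by
    have h1 : (m 0 : ℝ) * v 0 = ∑ i, (m i : ℝ) * k i - ∑ i, (m i : ℝ) * (g i * k 3) -
        m 1 * v 1 - m 2 * v 2 := by
      simp only [Fin.sum_univ_four, hg3, hv]
      ring
    have h2 : |(m 1 : ℝ) * v 1| ≤ lam * Q * (c * s) := by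
      rw [abs_mul, abs_of_pos (hm0 1)]
      exact mul_le_mul (hmb 1).2 hk1 (abs_nonneg _) (by positivity)
    have h3 : |(m 2 : ℝ) * v 2| ≤ lam * Q * (c * s) := by
      rw [abs_mul, abs_of_pos (hm0 2)]
      exact mul_le_mul (hmb 2).2 hk2 (abs_nonneg _) (by positivity)
    have h4 : |(m 0 : ℝ) * v 0| ≤ c + c * (L * κ) + lam * Q * (c * s) + lam * Q * (c * s) := by
      rw [h1]
      exact (abs_sub _ _).trans (add_le_add ((abs_sub _ _).trans (add_le_add ((abs_sub _ _).trans
        (add_le_add hkm hgFb)) h2)) h3)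
    rw [abs_mul, abs_of_pos (hm0 0)] at h4
    have h5 : Q / lam * |v 0| ≤ m 0 * |v 0| :=
      mul_le_mul_of_nonneg_right (hmb 0).1 (abs_nonneg _)
    have h6 : 1 ≤ Q * s := by
      calc (1 : ℝ) = Q * s * r := by rw [hs]; linarith
        _ ≤ Q * s * 1 := by gcongr
        _ = Q * s := mul_one _
    have h7 : Q / lam * |v 0| ≤ Q / lam * (c * V * s) := by
      refine h5.trans (h4.trans ?_)
      have h8 : c + c * (L * κ) ≤ (c + c * (L * κ)) * (Q * s) :=
        le_mul_of_one_le_right (by positivity) h6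
      have h9 : Q / lam * (c * V * s) =
          (c + c * (L * κ)) * (Q * s) + lam * Q * (c * s) + lam * Q * (c * s) := by
        rw [hV]; field_simp; ring
      linarith
    exact le_of_mul_le_mul_left h7 (by positivity)
  have hvb : ∀ i, |v i| ≤ c * V * s := by
    have h1 : c * s ≤ c * V * s := by
      rw [mul_right_comm]
      exact le_mul_of_one_le_right (by positivity) hV1
    intro i
    fin_cases i
    · exact hv0
    · exact hk1.trans h1
    · exact hk2.trans h1
    · simp only [Fin.reduceFinMk, hv3, abs_zero]; positivity
  have hk3' : k 3 ≠ 0 := by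
    intro h0
    apply hk0
    funext i
    have h1 := hvb i
    simp only [hv, h0, Int.cast_zero, mul_zero, sub_zero] at h1
    have h2 : c * V * s < 1 := by
      have : c * V ≤ 1 / 2 := le_trans (le_mul_of_one_le_right (by positivity) hG1) hcVG
      have : c * V * s ≤ c * V := mul_le_of_le_one_right (by positivity) hJr
      linarith
    have h3 : |k i| < 1 := by exact_mod_cast h1.trans_lt h2
    simpa using Int.abs_lt_one_iff.mp h3
  have hk3p : 1 ≤ |k 3| := Int.one_le_abs hk3'
  have hk3r : (1 : ℝ) ≤ |(k 3 : ℝ)| := by exact_mod_cast hk3p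
  set j : ℝ := |(k 3 : ℝ)| with hj
  have hj0 : 0 < j := by linarith
  have hjJ : j ≤ J := hk3.trans (mul_le_of_le_one_left hJ.le hc1)
  have hk3R : (k 3 : ℝ) ≠ 0 := by exact_mod_cast hk3'
  set x : Fin 4 → ℝ := fun i => k i / (g i * k 3) with hx
  set d : ℝ := V * G * (s / j) with hd
  have hkx : ∀ i, (k i : ℝ) = g i * k 3 * x i := fun i => by
    have := hg0 i
    simp only [hx]; field_simp
  have hxd' : ∀ i, |x i - 1| ≤ c * V * G * (s / j) := by
    intro i
    have h1 : x i - 1 = v i / (g i * k 3) := by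
      have := hg0 i
      simp only [hx, hv]; field_simp
    rw [h1, abs_div, abs_mul, hgabs, div_le_iff₀ (mul_pos (hγ0 i) hj0)]
    refine (hvb i).trans ?_
    have h2 : 1 ≤ G * γ i := by
      have := (hγb i).1
      rwa [div_le_iff₀' hG0] at this
    calc c * V * s ≤ c * V * s * (G * γ i) := le_mul_of_one_le_right (by positivity) h2
      _ = _ := by field_simp
  have hsj : s / j ≤ 1 := by rw [div_le_one hj0]; linarith
  have hsj0 : 0 < s / j := by positivity
  have hxd : ∀ i, |x i - 1| ≤ d := fun i => (hxd' i).trans (by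
    rw [hd]
    refine mul_le_mul_of_nonneg_right ?_ hsj0.le
    rw [mul_assoc]
    exact mul_le_of_le_one_left (by positivity) hc1)
  have hxhalf : ∀ i, |x i - 1| ≤ 1 / 2 := fun i => (hxd' i).trans
    ((mul_le_of_le_one_right (by positivity) hsj).trans hcVG)
  have hxlo : ∀ i, 1 / 2 ≤ x i := fun i => by linarith [(abs_le.mp (hxhalf i)).1]
  have hxhi : ∀ i, x i ≤ 3 / 2 := fun i => by linarith [(abs_le.mp (hxhalf i)).2]
  have hx0 : ∀ i, 0 < x i := fun i => by linarith [hxlo i]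
  have hkabs : ∀ i, |(k i : ℝ)| = γ i * j * x i := fun i => by
    rw [hkx i, abs_mul, abs_mul, hgabs, abs_of_pos (hx0 i)]
  have hangle : ∀ i, |(m i : ℝ) / m 0 - (|(k i : ℝ)| / |(k 0 : ℝ)|) ^ (1 / (α - 1))| ≤
      lam ^ 2 * (C₁ * (4 * (V * G))) * (s / j) := by
    intro i
    have h1 : |(k i : ℝ)| / |(k 0 : ℝ)| = ((m i : ℝ) / m 0) ^ (α - 1) * (x i / x 0) := by
      have := (hx0 0).ne'
      have := (Real.rpow_pos_of_pos (hm0 0) (α - 1)).ne'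
      rw [hkabs, hkabs]
      simp only [hγ, Real.div_rpow (hm0 _).le (hm0 _).le]
      field_simp
    have hz0 : 0 < x i / x 0 := div_pos (hx0 i) (hx0 0)
    have h2 : (|(k i : ℝ)| / |(k 0 : ℝ)|) ^ (1 / (α - 1)) =
        (m i : ℝ) / m 0 * (x i / x 0) ^ (1 / (α - 1)) := by
      have hq := div_pos (hm0 i) (hm0 0)
      rw [h1, Real.mul_rpow (Real.rpow_pos_of_pos hq _).le hz0.le, ← Real.rpow_mul hq.le,
        mul_one_div_cancel hα1', Real.rpow_one]
    have h3 : |x i / x 0 - 1| ≤ 4 * d := by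
      have : x i / x 0 - 1 = ((x i - 1) - (x 0 - 1)) / x 0 := by
        have := (hx0 0).ne'
        field_simp
        ring
      rw [this, abs_div, abs_of_pos (hx0 0), div_le_iff₀ (hx0 0)]
      have h4 := abs_sub (x i - 1) (x 0 - 1)
      have h5 := hxd i
      have h6 := hxd 0
      have h7 := hxlo 0
      have h8 : 4 * d * (1 / 2) ≤ 4 * d * x 0 :=
        mul_le_mul_of_nonneg_left h7 (by linarith [(abs_nonneg _).trans h5])
      linarith
    have h4 : |(x i / x 0) ^ (1 / (α - 1)) - 1| ≤ C₁ * |x i / x 0 - 1| := by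
      apply hC₁'
      · rw [div_le_div_iff₀ (by norm_num) (hx0 0)]
        linarith [hxlo i, hxhi 0]
      · rw [div_le_iff₀ (hx0 0)]
        linarith [hxlo 0, hxhi i]
    rw [h2, abs_sub_comm, ← mul_sub_one, abs_mul, abs_of_pos (div_pos (hm0 i) (hm0 0))]
    calc _ ≤ lam ^ 2 * (C₁ * (4 * d)) := by
          refine mul_le_mul (ratio i 0) (h4.trans ?_) (abs_nonneg _) (by positivity)
          gcongr
      _ = _ := by rw [hd]; ring
  refine ⟨⟨hk3p, hjJ⟩, ?_, ?_, hangle 1, hangle 2⟩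
  · intro i
    rw [hkabs i]
    have h1 := (hγb i).1
    have h2 := (hγb i).2
    rw [div_le_iff₀ hG0] at h1
    have h3 := hγ0 i
    constructor
    · rw [div_le_iff₀ (by positivity)]
      calc j = 1 * (1 / 2) * (2 * j) := by ring
        _ ≤ (γ i * G) * x i * (2 * j) := by
            gcongr
            exact hxlo i
        _ = _ := by ring
    · calc γ i * j * x i ≤ G * j * (3 / 2) := by
            gcongr
            · exact (hx0 i).le
            · exact hxhi i
        _ ≤ 2 * G * j := by linarith [mul_pos hG0 hj0]
  · have hp : ∀ i, |(m i : ℝ) ^ α| ≤ L' * Q ^ α := fun i => by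
      rw [abs_of_pos (Real.rpow_pos_of_pos (hm0 i) _)]
      exact (rpow_bounds_of_comparable hlam hQ (hmb i).1 (hmb i).2 α).1
    have hlin := hC₃' (fun i => (m i : ℝ) ^ α) x (L' * Q ^ α) d hp
      (fun i => ⟨hxlo i, by linarith [hxhi i]⟩) hxd
    have hA : ∑ i, quadSign i * (m i : ℝ) ^ α * x i ^ α' =
        (m 3 : ℝ) ^ α / j ^ α' * quadForm α' fun i => |k i| := by
      simp only [quadForm, mul_sum]
      refine sum_congr rfl fun i _ => ?_
      push_cast
      have hexp : (α - 1) * α' = α := by rw [hα']; field_simp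
      rw [hkabs i, Real.mul_rpow (mul_pos (hγ0 i) hj0).le (hx0 i).le,
        Real.mul_rpow (hγ0 i).le hj0.le]
      simp only [hγ]
      rw [← Real.rpow_mul (div_pos (hm0 i) (hm0 3)).le, hexp, Real.div_rpow (hm0 i).le (hm0 3).le]
      have := (Real.rpow_pos_of_pos (hm0 3) α).ne'
      have := (Real.rpow_pos_of_pos hj0 α').ne'
      field_simp
    have hB : ∑ i, quadSign i * (m i : ℝ) ^ α * x i =
        quadSign 3 * (m 3 : ℝ) ^ (α - 1) / k 3 * ∑ i, (m i : ℝ) * k i := by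
      simp only [mul_sum]
      refine sum_congr rfl fun i _ => ?_
      rw [hkx i]
      simp only [hg, hγ, Real.div_rpow (hm0 i).le (hm0 3).le]
      have h1 : (m i : ℝ) ^ α = m i ^ (α - 1) * m i := by
        rw [← Real.rpow_add_one (hm0 i).ne']; ring_nf
      rw [h1]
      have h2 := quadSign_mul_self 3
      field_simp
      linear_combination (-(quadSign i * (m i : ℝ) ^ (α - 1) * m i * x i)) * h2
    rw [hA, hB] at hlin
    change |_ - α' * _| ≤ |1 - α'| * |quadForm α m| + _ at hlin
    set S := quadForm α' fun i => |k i| with hS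
    set W := s ^ 2 / j ^ 2 with hW
    have hW0 : 0 < W := by positivity
    have hrW : r ^ 2 ≤ W := by
      rw [hW, hs, le_div_iff₀ (by positivity), mul_pow, mul_comm]
      gcongr
    have hQW : 1 / (Q * j) ≤ W := by
      have : 1 / (Q * j) = J * r ^ 2 / j := by
        field_simp
        linarith
      rw [this, hW, hs, div_le_div_iff₀ hj0 (by positivity)]
      calc J * r ^ 2 * j ^ 2 = (J * r ^ 2 * j) * j := by ring
        _ ≤ (J * r ^ 2 * j) * J := by gcongr
        _ = _ := by ring
    have hB' : |α' * (quadSign 3 * (m 3 : ℝ) ^ (α - 1) / k 3 * ∑ i, (m i : ℝ) * k i)| ≤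
        |α'| * L * W * Q ^ α := by
      rw [abs_mul α', abs_mul (_ / _), abs_div (_ * _), abs_mul (quadSign 3), abs_quadSign, one_mul,
        abs_of_pos hp3]
      have h1 := (rpow_bounds_of_comparable hlam hQ (hmb 3).1 (hmb 3).2 (α - 1)).1
      rw [Real.rpow_sub_one hQ.ne'] at h1
      calc _ ≤ |α'| * (L * (Q ^ α / Q) / j * 1) := by
            gcongr
            exact hkm.trans hc1
        _ = |α'| * L * (1 / (Q * j)) * Q ^ α := by field_simp
        _ ≤ _ := by gcongr
    have hF' : |1 - α'| * |quadForm α m| ≤ |1 - α'| * κ * W * Q ^ α := by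
      calc _ ≤ |1 - α'| * (κ * r ^ 2 * Q ^ α) := by gcongr
        _ ≤ |1 - α'| * (κ * W * Q ^ α) := by gcongr
        _ = _ := by ring
    have hd2 : C₃ * (L' * Q ^ α) * d ^ 2 = C₃ * L' * (V * G) ^ 2 * W * Q ^ α := by
      rw [hd, hW]; field_simp
    have hmain : |(m 3 : ℝ) ^ α / j ^ α' * S| ≤
        (|α'| * L + |1 - α'| * κ + C₃ * L' * (V * G) ^ 2) * W * Q ^ α := by
      have h1 := abs_sub_abs_le_abs_sub ((m 3 : ℝ) ^ α / j ^ α' * S)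
        (α' * (quadSign 3 * (m 3 : ℝ) ^ (α - 1) / k 3 * ∑ i, (m i : ℝ) * k i))
      rw [hd2] at hlin
      linarith
    have hm3 := Real.rpow_pos_of_pos (hm0 3) α
    have hjα := Real.rpow_pos_of_pos hj0 α'
    rw [abs_mul, abs_div, abs_of_pos hm3, abs_of_pos hjα] at hmain
    set B := |α'| * L + |1 - α'| * κ + C₃ * L' * (V * G) ^ 2 with hBdef
    have hB0 : 0 ≤ B := by positivity
    have h1 := (rpow_bounds_of_comparable hlam hQ (hmb 3).1 (hmb 3).2 α).2
    have h2 : (m 3 : ℝ) ^ α / j ^ α' * |S| ≤ (m 3 : ℝ) ^ α / j ^ α' * (L' * B * (j ^ α' * W)) := by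
      refine hmain.trans ?_
      calc B * W * Q ^ α ≤ B * W * (L' * (m 3 : ℝ) ^ α) := by gcongr
        _ = _ := by field_simp
    have h3 := le_of_mul_le_mul_left h2 (by positivity)
    refine h3.trans ?_
    rw [Real.rpow_sub hj0, Real.rpow_two]
    gcongr
    rw [hW]
    calc j ^ α' * (s ^ 2 / j ^ 2) ≤ j ^ α' * (1 / j ^ 2) := by
          gcongr
          exact pow_le_one₀ hs0.le hJr
      _ = _ := by ring

/-- Integer points with nonzero last coordinate, weighted by the inverse square of that coordinate,
are counted by dyadic ranges of `nearSol`. -/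
lemma sum_inv_sq_le_sum_nearSol {α Λ κ J : ℝ} (hΛ : 1 ≤ Λ) (hκ : 0 < κ) (U : Finset (Fin 4 → ℤ))
    (h1 : ∀ k ∈ U, 1 ≤ |k 3| ∧ |(k 3 : ℝ)| ≤ J)
    (h2 : ∀ k ∈ U, ∀ i, |(k 3 : ℝ)| / Λ ≤ |(k i : ℝ)| ∧ |(k i : ℝ)| ≤ Λ * |(k 3 : ℝ)|)
    (h3 : ∀ k ∈ U, |quadForm α (fun i => |k i|)| ≤ κ * |(k 3 : ℝ)| ^ (α - 2)) :
    ∑ k ∈ U, 1 / |(k 3 : ℝ)| ^ 2 ≤ 16 * ∑ i ∈ range (Nat.log 2 ⌊J⌋₊ + 1),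
      (1 / 4 : ℝ) ^ i * #(nearSol α (2 * Λ) (κ * 2 ^ |α - 2| / 4 ^ i) (2 ^ i)) := by
  classical
  set e : (Fin 4 → ℤ) → ℕ := fun k => Nat.log 2 (k 3).natAbs with he
  have hmaps : ∀ k ∈ U, e k ∈ range (Nat.log 2 ⌊J⌋₊ + 1) := by
    intro k hk
    rw [mem_range, Nat.lt_succ_iff]
    refine Nat.log_mono_right (Nat.le_floor ?_)
    rw [Nat.cast_natAbs]
    exact_mod_cast (h1 k hk).2
  have hpow : ∀ k ∈ U, (2 : ℝ) ^ e k ≤ |(k 3 : ℝ)| ∧ |(k 3 : ℝ)| ≤ 2 * 2 ^ e k := by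
    intro k hk
    have hk0 : (k 3).natAbs ≠ 0 := fun h => by
      simpa [Int.natAbs_eq_zero.mp h] using (h1 k hk).1
    have ha : |(k 3 : ℝ)| = ((k 3).natAbs : ℝ) := by rw [Nat.cast_natAbs, Int.cast_abs]
    rw [ha]
    constructor
    · exact_mod_cast Nat.pow_log_le_self 2 hk0
    · have := (Nat.lt_pow_succ_log_self (b := 2) (by norm_num) (k 3).natAbs).le
      rw [pow_succ'] at this
      exact_mod_cast this
  rw [← sum_fiberwise_of_maps_to hmaps, mul_sum]
  refine sum_le_sum fun i _ => ?_
  have hpi : (0 : ℝ) < 2 ^ i := by positivity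
  have hterm : ∀ k ∈ U.filter (fun k => e k = i), 1 / |(k 3 : ℝ)| ^ 2 ≤ (1 / 4 : ℝ) ^ i := by
    intro k hk
    obtain ⟨hkU, rfl⟩ := mem_filter.mp hk
    rw [one_div_pow, show (4 : ℝ) = 2 ^ 2 by norm_num, ← pow_mul, mul_comm, pow_mul]
    gcongr
    exact (hpow k hkU).1
  have hcard : #(U.filter (fun k => e k = i)) ≤
      #(nearSol α (2 * Λ) (κ * 2 ^ |α - 2| / 4 ^ i) (2 ^ i)) * 16 := by
    have : #(nearSol α (2 * Λ) (κ * 2 ^ |α - 2| / 4 ^ i) (2 ^ i)) * 16 =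
        #(nearSol α (2 * Λ) (κ * 2 ^ |α - 2| / 4 ^ i) (2 ^ i) ×ˢ
          (univ : Finset (Fin 4 → Bool))) := by
      rw [card_product]
      simp
    rw [this]
    refine card_le_card_of_injOn (fun k => (fun i => |k i|, fun i => decide (0 ≤ k i))) ?_ ?_
    · intro k hk
      obtain ⟨hkU, rfl⟩ := mem_filter.mp hk
      obtain ⟨hl, hu⟩ := hpow k hkU
      simp only [coe_product, coe_univ, Set.mem_prod, Set.mem_univ, and_true, mem_coe]
      rw [mem_nearSol (by linarith) hpi]
      constructor
      · intro i
        obtain ⟨ha, hb⟩ := h2 k hkU i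
        rw [div_le_iff₀ (by linarith)] at ha
        push_cast
        constructor
        · rw [div_le_iff₀ (by linarith)]
          have : 0 ≤ |(k i : ℝ)| * Λ := by positivity
          linarith
        · calc |(k i : ℝ)| ≤ Λ * (2 * 2 ^ e k) := hb.trans (by gcongr)
            _ = _ := by ring
      · refine (h3 k hkU).trans ?_
        have hb := (rpow_bounds_of_comparable (lam := 2) (by norm_num) hpi
          (hl.trans' (by linarith)) hu (α - 2)).1
        calc κ * |(k 3 : ℝ)| ^ (α - 2) ≤ κ * (2 ^ |α - 2| * (2 ^ e k) ^ (α - 2)) := by gcongr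
          _ = _ := by
            rw [Real.rpow_sub hpi, Real.rpow_two, ← pow_mul, mul_comm (e k) 2, pow_mul,
              show (2 : ℝ) ^ 2 = 4 by norm_num]
            ring
    · intro k _ k' _ hkk
      simp only [Prod.mk.injEq, funext_iff, decide_eq_decide] at hkk
      funext i
      have ha := hkk.1 i
      have hb := hkk.2 i
      rcases abs_cases (k i) with h | h <;> rcases abs_cases (k' i) with h' | h' <;> omega
  calc _ ≤ #(U.filter (fun k => e k = i)) • (1 / 4 : ℝ) ^ i := sum_le_card_nsmul _ _ _ hterm
    _ ≤ (#(nearSol α (2 * Λ) (κ * 2 ^ |α - 2| / 4 ^ i) (2 ^ i)) * 16 : ℕ) * (1 / 4 : ℝ) ^ i := by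
      rw [nsmul_eq_mul]
      gcongr
    _ = _ := by push_cast; ring

/-- The number of pairs of floors of reals confined to two intervals of length `2 * w`. -/
lemma card_floor_pairs_le {ι : Type*} (B : Finset ι) (f : ι → ℤ × ℤ)
    (hf : Set.InjOn f B) (t u : ι → ℝ) (θ η w : ℝ) (hw : 0 ≤ w)
    (ht : ∀ b ∈ B, (f b).1 = ⌊t b⌋ ∧ |t b - θ| ≤ w)
    (hu : ∀ b ∈ B, (f b).2 = ⌊u b⌋ ∧ |u b - η| ≤ w) :
    (#B : ℝ) ≤ (2 * w + 2) ^ 2 := by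
  have key : ∀ x : ℝ, (#(Icc ⌊x - w⌋ ⌊x + w⌋) : ℝ) ≤ 2 * w + 2 := by
    intro x
    rw [Int.card_Icc]
    have h0 : ⌊x - w⌋ ≤ ⌊x + w⌋ := Int.floor_mono (by linarith)
    have h1 : (((⌊x + w⌋ + 1 - ⌊x - w⌋).toNat : ℤ) : ℝ) = ⌊x + w⌋ + 1 - ⌊x - w⌋ := by
      rw [Int.toNat_of_nonneg (by omega)]; push_cast; ring
    have h2 := Int.floor_le (x + w)
    have h3 := Int.sub_one_lt_floor (x - w)
    rw [Int.cast_natCast] at h1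
    rw [h1]
    linarith
  have hc : #B ≤ #(Icc ⌊θ - w⌋ ⌊θ + w⌋ ×ˢ Icc ⌊η - w⌋ ⌊η + w⌋) := by
    refine card_le_card_of_injOn f ?_ hf
    intro b hb
    obtain ⟨h1, h2⟩ := ht b hb
    obtain ⟨h3, h4⟩ := hu b hb
    rw [abs_le] at h2 h4
    simp only [coe_product, Set.mem_prod, coe_Icc, Set.mem_Icc, h1, h3]
    refine ⟨⟨?_, ?_⟩, ?_, ?_⟩ <;> exact Int.floor_mono (by linarith)
  rw [card_product] at hc
  calc (#B : ℝ) ≤ (#(Icc ⌊θ - w⌋ ⌊θ + w⌋) : ℝ) * #(Icc ⌊η - w⌋ ⌊η + w⌋) := by exact_mod_cast hc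
    _ ≤ (2 * w + 2) * (2 * w + 2) := by
      gcongr
      · exact key θ
      · exact key η
    _ = _ := by ring

/-- The number of near-solutions is controlled by the numbers of near-solutions of smaller size for
the conjugate exponent. -/
lemma exists_card_nearSol_le_dual (α lam κ : ℝ) (hα : α ≠ 0) (hα1 : α ≠ 1) (hlam : 1 ≤ lam)
    (hκ : 0 < κ) :
    ∃ C : ℝ, 0 < C ∧ ∃ lam' : ℝ, 1 ≤ lam' ∧ ∃ κ' : ℝ, 0 < κ' ∧
      ∀ Q J : ℝ, 0 < J → 1 ≤ J * Q → J ≤ Q →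
        (#(nearSol α lam (κ / (J * Q)) Q) : ℝ) ≤ C * (Q ^ 3 / J + Q ^ 2 *
          ∑ i ∈ range (Nat.log 2 ⌊J⌋₊ + 1),
            (1 / 4 : ℝ) ^ i * #(nearSol (α / (α - 1)) lam' (κ' / 4 ^ i) (2 ^ i))) := by
  classical
  obtain ⟨c₁, hc₁, H₁⟩ := exists_card_le_dualBox α lam κ hα hlam hκ
  obtain ⟨c₂, hc₂, Λ, hΛ, κ', hκ', D, hD, H₂⟩ := exists_dualBox_bounds α lam κ hα1 hlam hκ
  set α' := α / (α - 1) with hα'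
  have hl : 0 < lam := by linarith
  set c := min c₁ c₂ with hc
  have hc0 : 0 < c := lt_min hc₁ hc₂
  set A := 64 * lam / c ^ 4 with hA
  have hA0 : 0 < A := by positivity
  refine ⟨A * (9 * lam ^ 4 + 16 * (2 * D + 2) ^ 2), by positivity, 2 * Λ, by linarith,
    κ' * 2 ^ |α' - 2|, by positivity, ?_⟩
  intro Q J hJ hJQ hJleQ
  have hQ : 0 < Q := by linarith
  set r := (√(J * Q))⁻¹ with hr
  have hJQ0 : 0 < J * Q := by positivity
  have hr0 : 0 < r := by positivity
  have hr2 : r ^ 2 = (J * Q)⁻¹ := by rw [hr, inv_pow, Real.sq_sqrt hJQ0.le]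
  have hJQr : J * Q * r ^ 2 = 1 := by rw [hr2, mul_inv_cancel₀ hJQ0.ne']
  have hr1 : r ≤ 1 := by
    rw [hr]
    exact inv_le_one_of_one_le₀ (Real.one_le_sqrt.mpr hJQ)
  have hJr : J * r ≤ 1 := by
    have : (J * r) ^ 2 ≤ 1 ^ 2 := by
      rw [mul_pow]
      calc J ^ 2 * r ^ 2 = J * r ^ 2 * J := by ring
        _ ≤ J * r ^ 2 * Q := by gcongr
        _ = 1 ^ 2 := by linarith
    exact le_of_sq_le_sq this (by norm_num)
  rw [show κ / (J * Q) = κ * r ^ 2 by rw [hr2]; rfl]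
  set N := nearSol α lam (κ * r ^ 2) Q with hN
  set f : (Fin 4 → ℤ) → ℤ × ℤ := fun n => (⌊(n 1 : ℝ) / n 0 / r⌋, ⌊(n 2 : ℝ) / n 0 / r⌋) with hf
  set B := N.image f with hB
  have hrep : ∀ b ∈ B, ∃ m ∈ N, f m = b := fun b hb => by simpa [hB] using hb
  choose! m hmN hmf using hrep
  have hcell : ∀ b ∈ B, ∃ K : Finset (Fin 4 → ℤ), (∀ k ∈ K, DualBox α c J r (m b) k) ∧
      (#(N.filter fun n => f n = b) : ℝ) ≤ A * (Q / J) ^ 2 * #K := by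
    intro b hb
    refine H₁ c hc0 (min_le_left _ _) Q r J hQ hJ hr0 hr1 hJQr (m b) (hmN b hb) _
      (filter_subset _ _) fun n hn => ?_
    have hnb := (mem_filter.mp hn).2.trans (hmf b hb).symm
    simp only [hf, Prod.mk.injEq] at hnb
    have aux : ∀ x y : ℝ, ⌊x / r⌋ = ⌊y / r⌋ → |x - y| ≤ r := by
      intro x y hxy
      have := (Int.abs_sub_lt_one_of_floor_eq_floor hxy).le
      rwa [← sub_div, abs_div, abs_of_pos hr0, div_le_one hr0] at this
    exact ⟨aux _ _ hnb.1, aux _ _ hnb.2⟩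
  choose! K hKbox hKcard using hcell
  have hbounds := fun b (hb : b ∈ B) k (hk : k ∈ (K b).erase 0) =>
    H₂ c hc0 (min_le_right _ _) Q r J hQ hJ hr0 hr1 hJr hJQr (m b) (hmN b hb) k
      (hKbox b hb k (mem_of_mem_erase hk)) (ne_of_mem_erase hk)
  have hBinj : Set.InjOn (id : ℤ × ℤ → ℤ × ℤ) B := fun _ _ _ _ h => h
  have hBcard : (#B : ℝ) ≤ 9 * lam ^ 4 * (J * Q) := by
    have hmem : ∀ b ∈ B, ∀ i, |((m b i : ℝ) / m b 0 / r) - lam ^ 2 / r / 2| ≤ lam ^ 2 / r / 2 := by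
      intro b hb i
      obtain ⟨hmb, -⟩ := (mem_nearSol hl hQ).mp (hmN b hb)
      have h0 : ∀ i, (0 : ℝ) < m b i := fun i => lt_of_lt_of_le (by positivity) (hmb i).1
      have hratio : (m b i : ℝ) / m b 0 ≤ lam ^ 2 := by
        have h1 := (hmb 0).1
        have h2 := (hmb i).2
        rw [div_le_iff₀ hl] at h1
        rw [div_le_iff₀ (h0 0)]
        nlinarith
      have h3 : (m b i : ℝ) / m b 0 / r ≤ lam ^ 2 / r := by gcongr
      have h4 : 0 ≤ (m b i : ℝ) / m b 0 / r := (div_pos (div_pos (h0 i) (h0 0)) hr0).le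
      rw [abs_le]
      constructor <;> linarith
    have := card_floor_pairs_le B id hBinj (fun b => (m b 1 : ℝ) / m b 0 / r)
      (fun b => (m b 2 : ℝ) / m b 0 / r) _ _ _ (by positivity)
      (fun b hb => ⟨congrArg Prod.fst (hmf b hb).symm, hmem b hb 1⟩)
      (fun b hb => ⟨congrArg Prod.snd (hmf b hb).symm, hmem b hb 2⟩)
    refine this.trans ?_
    have h1 : 1 ≤ lam ^ 2 / r := (one_le_div hr0).mpr (hr1.trans (one_le_pow₀ hlam))
    calc (2 * (lam ^ 2 / r / 2) + 2) ^ 2 ≤ (3 * (lam ^ 2 / r)) ^ 2 := by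
          gcongr
          linarith
      _ = 9 * lam ^ 4 * (r ^ 2)⁻¹ := by rw [mul_pow, div_pow]; ring
      _ = _ := by rw [hr2, inv_inv]
  have hmult : ∀ k, (#(B.filter fun b => k ∈ (K b).erase 0) : ℝ) ≤
      (2 * D + 2) ^ 2 * J ^ 2 * (1 / |(k 3 : ℝ)| ^ 2) := by
    intro k
    rcases (B.filter fun b => k ∈ (K b).erase 0).eq_empty_or_nonempty with h | ⟨b₀, hb₀⟩
    · rw [h]; simp; positivity
    obtain ⟨hb₀B, hb₀k⟩ := mem_filter.mp hb₀
    obtain ⟨⟨hk1, hkJ⟩, -⟩ := hbounds b₀ hb₀B k hb₀k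
    have hk1' : (1 : ℝ) ≤ |(k 3 : ℝ)| := by exact_mod_cast hk1
    set j := |(k 3 : ℝ)| with hj
    have hj0 : 0 < j := by linarith
    have aux : ∀ x y : ℝ, |x - y| ≤ D * (J * r / j) → |x / r - y / r| ≤ D * (J / j) := by
      intro x y h
      rw [← sub_div, abs_div, abs_of_pos hr0, div_le_iff₀ hr0]
      exact h.trans (le_of_eq (by ring))
    have := card_floor_pairs_le (B.filter fun b => k ∈ (K b).erase 0) id (fun _ _ _ _ h => h)
      (fun b => (m b 1 : ℝ) / m b 0 / r) (fun b => (m b 2 : ℝ) / m b 0 / r)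
      ((|(k 1 : ℝ)| / |(k 0 : ℝ)|) ^ (1 / (α - 1)) / r)
      ((|(k 2 : ℝ)| / |(k 0 : ℝ)|) ^ (1 / (α - 1)) / r) (D * (J / j)) (by positivity)
      (fun b hb => ?_) (fun b hb => ?_)
    · refine this.trans ?_
      have h1 : 1 ≤ J / j := (one_le_div hj0).mpr hkJ
      calc (2 * (D * (J / j)) + 2) ^ 2 ≤ ((2 * D + 2) * (J / j)) ^ 2 := by
            gcongr
            linarith
        _ = _ := by rw [mul_pow, div_pow]; ring
    · obtain ⟨hbB, hbk⟩ := mem_filter.mp hb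
      exact ⟨congrArg Prod.fst (hmf b hbB).symm, aux _ _ (hbounds b hbB k hbk).2.2.2.1⟩
    · obtain ⟨hbB, hbk⟩ := mem_filter.mp hb
      exact ⟨congrArg Prod.snd (hmf b hbB).symm, aux _ _ (hbounds b hbB k hbk).2.2.2.2⟩
  set U := B.biUnion fun b => (K b).erase 0 with hU
  have hUex : ∀ k ∈ U, ∃ b ∈ B, k ∈ (K b).erase 0 := fun k hk => by
    simpa only [hU, mem_biUnion] using hk
  set M := ∑ i ∈ range (Nat.log 2 ⌊J⌋₊ + 1),
    (1 / 4 : ℝ) ^ i * #(nearSol α' (2 * Λ) (κ' * 2 ^ |α' - 2| / 4 ^ i) (2 ^ i)) with hM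
  have hUsum : ∑ k ∈ U, 1 / |(k 3 : ℝ)| ^ 2 ≤ 16 * M := by
    refine sum_inv_sq_le_sum_nearSol hΛ hκ' U (fun k hk => ?_) (fun k hk => ?_) fun k hk => ?_ <;>
      obtain ⟨b, hb, hbk⟩ := hUex k hk
    · exact (hbounds b hb k hbk).1
    · exact (hbounds b hb k hbk).2.1
    · exact (hbounds b hb k hbk).2.2.1
  have hM0 : 0 ≤ M := sum_nonneg fun i _ =>
    mul_nonneg (pow_nonneg (by norm_num) i) (Nat.cast_nonneg _)
  clear_value M
  have hKsum : (∑ b ∈ B, (#((K b).erase 0) : ℝ)) ≤ (2 * D + 2) ^ 2 * J ^ 2 * (16 * M) := by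
    have h1 : ∑ b ∈ B, #((K b).erase 0) = ∑ k ∈ U, #(B.filter fun b => k ∈ (K b).erase 0) := by
      refine Eq.trans (sum_congr rfl fun b hb => congrArg card ?_)
        (sum_card_bipartiteAbove_eq_sum_card_bipartiteBelow (s := B) (t := U)
          fun b k => k ∈ (K b).erase 0)
      ext k
      simp only [bipartiteAbove, mem_filter, hU, mem_biUnion]
      exact ⟨fun h => ⟨⟨b, hb, h⟩, h⟩, fun h => h.2⟩
    have h2 : (∑ b ∈ B, (#((K b).erase 0) : ℝ)) =
        ∑ k ∈ U, (#(B.filter fun b => k ∈ (K b).erase 0) : ℝ) := by exact_mod_cast h1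
    rw [h2]
    refine (sum_le_sum fun k _ => hmult k).trans ?_
    rw [← mul_sum]
    gcongr
  have hNsum : (#N : ℝ) ≤ A * (Q / J) ^ 2 * (#B + ∑ b ∈ B, (#((K b).erase 0) : ℝ)) := by
    rw [card_eq_sum_card_image f N]
    push_cast
    refine (sum_le_sum fun b hb => hKcard b hb).trans ?_
    rw [← mul_sum]
    gcongr
    rw [card_eq_sum_ones, Nat.cast_sum, ← sum_add_distrib]
    refine sum_le_sum fun b _ => ?_
    have : #(K b) ≤ 1 + #((K b).erase 0) := by
      have := pred_card_le_card_erase (s := K b) (a := 0)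
      omega
    exact_mod_cast this
  have h1 : (Q / J) ^ 2 * (J * Q) = Q ^ 3 / J := by
    clear * - hJ
    field_simp
  have h2 : (Q / J) ^ 2 * J ^ 2 = Q ^ 2 := by
    rw [← mul_pow, div_mul_cancel₀ _ hJ.ne']
  have h3 : (#N : ℝ) ≤ A * (Q / J) ^ 2 *
      (9 * lam ^ 4 * (J * Q) + (2 * D + 2) ^ 2 * J ^ 2 * (16 * M)) :=
    hNsum.trans (mul_le_mul_of_nonneg_left (add_le_add hBcard hKsum) (by positivity))
  have h4 : 0 ≤ A * (9 * lam ^ 4) * (Q ^ 2 * M) := by positivity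
  have h5 : 0 ≤ A * (16 * (2 * D + 2) ^ 2) * (Q ^ 3 / J) := by positivity
  have h6 : A * (Q / J) ^ 2 * (9 * lam ^ 4 * (J * Q) + (2 * D + 2) ^ 2 * J ^ 2 * (16 * M)) =
      A * (9 * lam ^ 4) * (Q ^ 3 / J) + A * (16 * (2 * D + 2) ^ 2) * (Q ^ 2 * M) := by
    linear_combination A * (9 * lam ^ 4) * h1 + A * (16 * (2 * D + 2) ^ 2) * M * h2
  have h7 : A * (9 * lam ^ 4 + 16 * (2 * D + 2) ^ 2) * (Q ^ 3 / J + Q ^ 2 * M) =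
      A * (9 * lam ^ 4) * (Q ^ 3 / J) + A * (16 * (2 * D + 2) ^ 2) * (Q ^ 2 * M) +
      (A * (9 * lam ^ 4) * (Q ^ 2 * M) + A * (16 * (2 * D + 2) ^ 2) * (Q ^ 3 / J)) := by ring
  linarith

lemma nearSol_mono {α lam ρ ρ' Q : ℝ} (hQ : 0 ≤ Q) (h : ρ ≤ ρ') :
    nearSol α lam ρ Q ⊆ nearSol α lam ρ' Q := by
  intro n hn
  simp only [nearSol, mem_filter] at hn ⊢
  exact ⟨hn.1, hn.2.1, hn.2.2.trans (mul_le_mul_of_nonneg_right h (Real.rpow_nonneg hQ _))⟩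

lemma card_nearSol_le_pow {α lam ρ Q : ℝ} (hlam : 0 ≤ lam) (hQ : 0 ≤ Q) :
    (#(nearSol α lam ρ Q) : ℝ) ≤ (lam * Q) ^ 4 := by
  have h1 : #(nearSol α lam ρ Q) ≤ ⌊lam * Q⌋₊ ^ 4 := by
    refine (card_filter_le _ _).trans (le_of_eq ?_)
    simp [Fintype.card_piFinset, Int.floor_toNat]
  calc (#(nearSol α lam ρ Q) : ℝ) ≤ (⌊lam * Q⌋₊ : ℝ) ^ 4 := by exact_mod_cast h1
    _ ≤ _ := by
      gcongr
      exact Nat.floor_le (by positivity)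

/-- The number of near-solutions at the critical scale is at most a constant times `Q ^ (2 + β)`,
for every admissible exponent. -/
def CriticalBound (β : ℝ) : Prop :=
  ∀ α lam κ : ℝ, α ≠ 0 → α ≠ 1 → 1 ≤ lam → 0 < κ → ∃ C : ℝ, 0 < C ∧ ∀ Q : ℝ, 1 ≤ Q →
    (#(nearSol α lam (κ / Q ^ 2) Q) : ℝ) ≤ C * Q ^ (2 + β)

lemma CriticalBound.exists_sum_le {β : ℝ} (h : CriticalBound β) (hβ : 0 < β) {α lam κ : ℝ}
    (hα : α ≠ 0) (hα1 : α ≠ 1) (hlam : 1 ≤ lam) (hκ : 0 < κ) :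
    ∃ C : ℝ, 0 < C ∧ ∀ J : ℝ, ∑ i ∈ range (Nat.log 2 ⌊J⌋₊ + 1),
      (1 / 4 : ℝ) ^ i * #(nearSol α lam (κ / 4 ^ i) (2 ^ i)) ≤ C * max 1 J ^ β := by
  obtain ⟨C, hC, H⟩ := h α lam κ hα hα1 hlam hκ
  set x : ℝ := 2 ^ β with hx
  have hx1 : 1 < x := Real.one_lt_rpow (by norm_num) hβ
  have hx2 : 0 < x - 1 := by linarith
  refine ⟨C * (x / (x - 1)), by positivity, fun J => ?_⟩
  set n := Nat.log 2 ⌊J⌋₊ with hn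
  have hterm : ∀ i ∈ range (n + 1),
      (1 / 4 : ℝ) ^ i * #(nearSol α lam (κ / 4 ^ i) (2 ^ i)) ≤ C * x ^ i := by
    intro i _
    have h1 := H (2 ^ i) (one_le_pow₀ (by norm_num))
    have h4 : ((2 : ℝ) ^ i) ^ 2 = 4 ^ i := by
      rw [← pow_mul, mul_comm, pow_mul]; norm_num
    rw [h4, Real.rpow_add (by positivity), Real.rpow_two, h4, ← Real.rpow_natCast_mul (by norm_num),
      mul_comm (i : ℝ) β, Real.rpow_mul_natCast (by norm_num)] at h1
    calc _ ≤ (1 / 4 : ℝ) ^ i * (C * (4 ^ i * x ^ i)) := by gcongr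
      _ = C * x ^ i * ((1 / 4 : ℝ) ^ i * 4 ^ i) := by ring
      _ = C * x ^ i := by rw [← mul_pow]; norm_num
  have hJ : x ^ n ≤ max 1 J ^ β := by
    rw [hx, ← Real.rpow_mul_natCast (by norm_num), mul_comm, Real.rpow_natCast_mul (by norm_num)]
    refine Real.rpow_le_rpow (by positivity) ?_ hβ.le
    rcases Nat.eq_zero_or_pos ⌊J⌋₊ with h0 | h0
    · simp [hn, h0]
    · refine le_max_of_le_right ?_
      calc (2 : ℝ) ^ n ≤ ⌊J⌋₊ := by exact_mod_cast Nat.pow_log_le_self 2 h0.ne'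
        _ ≤ J := Nat.floor_le (by linarith [Nat.floor_pos.mp h0])
  calc _ ≤ ∑ i ∈ range (n + 1), C * x ^ i := sum_le_sum hterm
    _ = C * ((x ^ (n + 1) - 1) / (x - 1)) := by rw [← mul_sum, geom_sum_eq hx1.ne']
    _ ≤ C * (x ^ (n + 1) / (x - 1)) := by gcongr; linarith
    _ = C * (x / (x - 1)) * x ^ n := by ring
    _ ≤ _ := by gcongr

lemma CriticalBound.exists_card_le {β : ℝ} (h : CriticalBound β) (hβ : 0 < β) {α lam κ : ℝ}
    (hα : α ≠ 0) (hα1 : α ≠ 1) (hlam : 1 ≤ lam) (hκ : 0 < κ) :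
    ∃ C : ℝ, 0 < C ∧ ∀ Q J : ℝ, 0 < J → 1 ≤ J * Q → J ≤ Q →
      (#(nearSol α lam (κ / (J * Q)) Q) : ℝ) ≤ C * (Q ^ 3 / J + Q ^ 2 * max 1 J ^ β) := by
  obtain ⟨C, hC, lam', hlam', κ', hκ', H⟩ := exists_card_nearSol_le_dual α lam κ hα hα1 hlam hκ
  have hα1' : α - 1 ≠ 0 := sub_ne_zero.mpr hα1
  obtain ⟨C', hC', H'⟩ := h.exists_sum_le hβ (α := α / (α - 1)) (div_ne_zero hα hα1')
    (by rw [ne_eq, div_eq_one_iff_eq hα1']; intro h; linarith) hlam' hκ'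
  refine ⟨C * (1 + C'), by positivity, fun Q J hJ hJQ hJQ' => (H Q J hJ hJQ hJQ').trans ?_⟩
  have hQ : 0 < Q := by linarith
  rw [mul_assoc]
  refine mul_le_mul_of_nonneg_left ?_ hC.le
  have h1 : 0 ≤ C' * (Q ^ 3 / J) := by positivity
  have h2 : 0 ≤ Q ^ 2 * max 1 J ^ β := by positivity
  have h3 := mul_le_mul_of_nonneg_left (H' J) (sq_nonneg Q)
  linarith

lemma CriticalBound.improve {β : ℝ} (h : CriticalBound β) (hβ : 0 < β) :
    CriticalBound (β / (1 + β)) := by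
  intro α lam κ hα hα1 hlam hκ
  obtain ⟨C, hC, H⟩ := h.exists_card_le hβ hα hα1 hlam hκ
  refine ⟨2 * C, by positivity, fun Q hQ => ?_⟩
  have hQ0 : 0 < Q := by linarith
  have hβ1 : (0 : ℝ) < 1 + β := by linarith
  set J := Q ^ (1 / (1 + β)) with hJ
  have hJ1 : 1 ≤ J := Real.one_le_rpow hQ (by positivity)
  have hJQ : J ≤ Q := by
    calc J ≤ Q ^ (1 : ℝ) := Real.rpow_le_rpow_of_exponent_le hQ
          (by rw [div_le_one hβ1]; linarith)
      _ = Q := Real.rpow_one Q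
  have h1 : κ / Q ^ 2 ≤ κ / (J * Q) := by
    gcongr
    rw [sq]
    gcongr
  have h2 : Q ^ 3 / J = Q ^ (2 + β / (1 + β)) := by
    rw [hJ, ← Real.rpow_natCast, ← Real.rpow_sub hQ0]
    congr 1
    field_simp
    push_cast
    ring
  have h3 : Q ^ 2 * J ^ β = Q ^ (2 + β / (1 + β)) := by
    rw [hJ, ← Real.rpow_mul hQ0.le, ← Real.rpow_two, ← Real.rpow_add hQ0]
    congr 1
    ring
  have h4 := H Q J (by linarith) (by nlinarith) hJQ
  rw [max_eq_right hJ1, h2, h3] at h4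
  have h5 : (#(nearSol α lam (κ / Q ^ 2) Q) : ℝ) ≤ #(nearSol α lam (κ / (J * Q)) Q) := by
    exact_mod_cast card_le_card (nearSol_mono hQ0.le h1)
  linarith

lemma CriticalBound.mono {β β' : ℝ} (h : CriticalBound β) (hβ : β ≤ β') : CriticalBound β' := by
  intro α lam κ hα hα1 hlam hκ
  obtain ⟨C, hC, H⟩ := h α lam κ hα hα1 hlam hκ
  refine ⟨C, hC, fun Q hQ => (H Q hQ).trans ?_⟩
  gcongr

lemma criticalBound_two_div (k : ℕ) : CriticalBound (2 / (2 * k + 1)) := by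
  induction k with
  | zero =>
    intro α lam κ _ _ hlam _
    refine ⟨lam ^ 4, by positivity, fun Q hQ => (card_nearSol_le_pow (by linarith)
      (by linarith)).trans (le_of_eq ?_)⟩
    rw [mul_pow, ← Real.rpow_natCast Q]
    norm_num
  | succ k ih =>
    convert ih.improve (by positivity) using 1
    field_simp
    push_cast
    ring

lemma criticalBound {β : ℝ} (hβ : 0 < β) : CriticalBound β := by
  obtain ⟨k, hk⟩ := exists_nat_gt (1 / β)
  refine (criticalBound_two_div k).mono ?_
  rw [div_lt_iff₀ hβ] at hk
  rw [div_le_iff₀ (by positivity)]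
  nlinarith

/-- A bound of Robert and Sargos for the number of quadruples with `quadForm α` small. -/
theorem exists_card_nearSol_le {α lam ε : ℝ} (hα : α ≠ 0) (hα1 : α ≠ 1) (hlam : 1 ≤ lam)
    (hε : 0 < ε) :
    ∃ C : ℝ, 0 < C ∧ ∀ Q ρ : ℝ, 1 ≤ Q → 0 ≤ ρ →
      (#(nearSol α lam ρ Q) : ℝ) ≤ C * (ρ * Q ^ 4 + Q ^ (2 + ε)) := by
  obtain ⟨C, hC, H⟩ := (criticalBound hε).exists_card_le hε hα hα1 hlam one_pos
  refine ⟨lam ^ 4 + 2 * C, by positivity, fun Q ρ hQ hρ => ?_⟩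
  have hQ0 : 0 < Q := by linarith
  have hρQ : 0 ≤ ρ * Q ^ 4 := by positivity
  have hQε : 0 < Q ^ (2 + ε) := by positivity
  rcases le_total 1 ρ with h1 | h1
  · calc (#(nearSol α lam ρ Q) : ℝ) ≤ (lam * Q) ^ 4 :=
          card_nearSol_le_pow (by linarith) hQ0.le
      _ = lam ^ 4 * (1 * Q ^ 4 + 0) := by ring
      _ ≤ (lam ^ 4 + 2 * C) * (ρ * Q ^ 4 + Q ^ (2 + ε)) := by
        gcongr
        linarith
  · set σ := max ρ (1 / Q ^ 2) with hσ
    have hσ0 : 0 < σ := lt_max_of_lt_right (by positivity)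
    have hσ1 : σ ≤ 1 := max_le h1 (by rw [div_le_one (by positivity)]; exact one_le_pow₀ hQ)
    have hσQ : 1 ≤ σ * Q ^ 2 := by
      rw [← div_le_iff₀ (by positivity)]
      exact le_max_right _ _
    have hJ : 1 / (σ * Q) * Q = 1 / σ := by field_simp
    have hJQ : 1 / (σ * Q) ≤ Q := by
      rw [div_le_iff₀ (by positivity)]
      linarith
    have h2 := H Q (1 / (σ * Q)) (by positivity)
      (by rw [hJ]; exact (one_le_div hσ0).mpr hσ1) hJQ
    rw [hJ, one_div_one_div] at h2
    have h3 : Q ^ 3 / (1 / (σ * Q)) = σ * Q ^ 4 := by field_simp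
    have h4 : σ * Q ^ 4 ≤ ρ * Q ^ 4 + Q ^ (2 + ε) := by
      rcases max_choice ρ (1 / Q ^ 2) with h | h
      · rw [hσ, h]; linarith
      · rw [hσ, h]
        have : 1 / Q ^ 2 * Q ^ 4 = Q ^ (2 : ℝ) := by
          rw [Real.rpow_two]; field_simp
        rw [this]
        have := Real.rpow_le_rpow_of_exponent_le hQ (show (2 : ℝ) ≤ 2 + ε by linarith)
        linarith
    have h5 : Q ^ 2 * max 1 (1 / (σ * Q)) ^ ε ≤ Q ^ (2 + ε) := by
      rw [Real.rpow_add hQ0, Real.rpow_two]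
      gcongr
      exact max_le hQ hJQ
    have h6 : (#(nearSol α lam ρ Q) : ℝ) ≤ #(nearSol α lam σ Q) := by
      exact_mod_cast card_le_card (nearSol_mono hQ0.le (le_max_left _ _))
    rw [h3] at h2
    calc _ ≤ C * (ρ * Q ^ 4 + Q ^ (2 + ε) + (ρ * Q ^ 4 + Q ^ (2 + ε))) := by
          refine h6.trans (h2.trans ?_)
          gcongr
          linarith
      _ ≤ _ := by
          have : 0 ≤ lam ^ 4 * (ρ * Q ^ 4 + Q ^ (2 + ε)) := by positivity
          linarith

lemma norm_integral_exp_rpow_quarter_le {T Δ : ℝ} (hT : 0 < T) (hΔ : Δ ≠ 0) :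
    ‖∫ x in T..(2 * T), Complex.exp (2 * π * Complex.I * ((4 * Δ * x ^ ((1 : ℝ) / 4) : ℝ) : ℂ))‖ ≤
      T ^ ((3 : ℝ) / 4) / |Δ| := by
  set E : ℝ → ℂ := fun x =>
    Complex.exp (2 * π * Complex.I * ((4 * Δ * x ^ ((1 : ℝ) / 4) : ℝ) : ℂ)) with hE
  have hEnorm : ∀ x, ‖E x‖ = 1 := fun x => by
    simp only [hE]
    rw [show 2 * (π : ℂ) * Complex.I * ((4 * Δ * x ^ ((1 : ℝ) / 4) : ℝ) : ℂ) =
      ((2 * π * (4 * Δ * x ^ ((1 : ℝ) / 4)) : ℝ) : ℂ) * Complex.I by push_cast; ring]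
    exact Complex.norm_exp_ofReal_mul_I _
  have hEcont : Continuous E := by
    have : Continuous fun x : ℝ => x ^ ((1 : ℝ) / 4) :=
      Real.continuous_rpow_const (by norm_num)
    simp only [hE]
    fun_prop
  have hpos : ∀ x ∈ Set.uIcc T (2 * T), T ≤ x := fun x hx => by
    rw [Set.uIcc_of_le (by linarith)] at hx
    exact hx.1
  have hder : ∀ x ∈ Set.uIcc T (2 * T),
      HasDerivAt (fun x : ℝ => ((x ^ ((3 : ℝ) / 4) : ℝ) : ℂ) * E x)
      ((((3 : ℝ) / 4 * x ^ (-(1 : ℝ) / 4) : ℝ) : ℂ) * E x + 2 * π * Complex.I * Δ * E x) x := by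
    intro x hx
    have hx0 : 0 < x := hT.trans_le (hpos x hx)
    have h1 : HasDerivAt (fun x : ℝ => x ^ ((3 : ℝ) / 4)) ((3 : ℝ) / 4 * x ^ (-(1 : ℝ) / 4)) x := by
      refine (Real.hasDerivAt_rpow_const (p := (3 : ℝ) / 4) (Or.inl hx0.ne')).congr_deriv ?_
      norm_num
    have h2 : HasDerivAt (fun x : ℝ => 4 * Δ * x ^ ((1 : ℝ) / 4)) (Δ * x ^ (-(3 : ℝ) / 4)) x := by
      refine ((Real.hasDerivAt_rpow_const (p := (1 : ℝ) / 4) (Or.inl hx0.ne')).const_mul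
        (4 * Δ)).congr_deriv ?_
      norm_num
      ring
    have h3 := (h2.ofReal_comp.const_mul (2 * π * Complex.I)).cexp
    refine (h1.ofReal_comp.mul h3).congr_deriv ?_
    have h4 : x ^ ((3 : ℝ) / 4) * x ^ (-(3 : ℝ) / 4) = 1 := by
      rw [← Real.rpow_add hx0]; norm_num
    have h5 : ((x ^ ((3 : ℝ) / 4) : ℝ) : ℂ) * ((x ^ (-(3 : ℝ) / 4) : ℝ) : ℂ) = 1 := by
      exact_mod_cast h4
    simp only [hE]
    push_cast at h5 ⊢
    linear_combination (2 * π * Complex.I * Δ *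
      Complex.exp (2 * π * Complex.I * (4 * Δ * ((x ^ ((1 : ℝ) / 4) : ℝ) : ℂ)))) * h5
  have hc1 : ContinuousOn (fun x : ℝ => (((3 : ℝ) / 4 * x ^ (-(1 : ℝ) / 4) : ℝ) : ℂ) * E x)
      (Set.uIcc T (2 * T)) := by
    refine ContinuousOn.mul (Complex.continuous_ofReal.comp_continuousOn
      (continuousOn_const.mul (ContinuousOn.rpow_const continuousOn_id fun x hx => Or.inl ?_)))
      hEcont.continuousOn
    exact (hT.trans_le (hpos x hx)).ne'
  have hi1 := hc1.intervalIntegrable (μ := MeasureTheory.volume)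
  have hi2 : IntervalIntegrable (fun x => 2 * π * Complex.I * Δ * E x) MeasureTheory.volume
      T (2 * T) := (hEcont.const_mul _).intervalIntegrable _ _
  have hftc := intervalIntegral.integral_eq_sub_of_hasDerivAt hder (hi1.add hi2)
  rw [intervalIntegral.integral_add hi1 hi2, intervalIntegral.integral_const_mul] at hftc
  have hT34 : 0 < T ^ ((3 : ℝ) / 4) := by positivity
  have h2T : (2 * T) ^ ((3 : ℝ) / 4) ≤ 2 * T ^ ((3 : ℝ) / 4) := by
    rw [Real.mul_rpow (by norm_num) hT.le]
    gcongr
    calc (2 : ℝ) ^ ((3 : ℝ) / 4) ≤ 2 ^ (1 : ℝ) :=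
          Real.rpow_le_rpow_of_exponent_le (by norm_num) (by norm_num)
      _ = 2 := Real.rpow_one 2
  have hb1 : ‖∫ x in T..(2 * T), (((3 : ℝ) / 4 * x ^ (-(1 : ℝ) / 4) : ℝ) : ℂ) * E x‖ ≤
      T ^ ((3 : ℝ) / 4) := by
    refine (intervalIntegral.norm_integral_le_of_norm_le_const (C := T ^ (-(1 : ℝ) / 4))
      fun x hx => ?_).trans (le_of_eq ?_)
    · have hx' := hpos x (Set.uIoc_subset_uIcc hx)
      have hx0 : 0 < x := hT.trans_le hx'
      rw [norm_mul, hEnorm, mul_one, Complex.norm_real, Real.norm_eq_abs,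
        abs_of_pos (by positivity)]
      calc (3 : ℝ) / 4 * x ^ (-(1 : ℝ) / 4) ≤ 1 * x ^ (-(1 : ℝ) / 4) := by
            gcongr
            norm_num
        _ ≤ _ := by
            rw [one_mul]
            exact Real.rpow_le_rpow_of_nonpos hT hx' (by norm_num)
    · rw [show 2 * T - T = T by ring, abs_of_pos hT, ← Real.rpow_add_one hT.ne']
      norm_num
  have hmain : 2 * π * |Δ| * ‖∫ x in T..(2 * T), E x‖ ≤ 4 * T ^ ((3 : ℝ) / 4) := by
    have h1 : 2 * π * |Δ| * ‖∫ x in T..(2 * T), E x‖ =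
        ‖2 * π * Complex.I * Δ * ∫ x in T..(2 * T), E x‖ := by
      simp [abs_of_pos Real.pi_pos]
    rw [h1, eq_sub_of_add_eq' hftc]
    refine (norm_sub_le _ _).trans ?_
    have h2 := norm_sub_le (((2 * T) ^ ((3 : ℝ) / 4) : ℝ) * E (2 * T) : ℂ)
      ((T ^ ((3 : ℝ) / 4) : ℝ) * E T)
    rw [norm_mul, norm_mul, hEnorm, hEnorm, mul_one, mul_one, Complex.norm_real, Complex.norm_real,
      Real.norm_eq_abs, Real.norm_eq_abs, abs_of_pos hT34, abs_of_pos (by positivity)] at h2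
    linarith
  have hΔ0 : 0 < |Δ| := abs_pos.mpr hΔ
  rw [le_div_iff₀ hΔ0]
  have h3 : 0 ≤ |Δ| * ‖∫ x in T..(2 * T), E x‖ := by positivity
  nlinarith [Real.pi_gt_three]

lemma norm_integral_exp_rpow_quarter_le_self {T Δ : ℝ} (hT : 0 < T) :
    ‖∫ x in T..(2 * T), Complex.exp (2 * π * Complex.I * ((4 * Δ * x ^ ((1 : ℝ) / 4) : ℝ) : ℂ))‖ ≤
      T := by
  refine (intervalIntegral.norm_integral_le_of_norm_le_const (C := 1) fun x _ => ?_).trans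
    (le_of_eq ?_)
  · rw [show 2 * (π : ℂ) * Complex.I * ((4 * Δ * x ^ ((1 : ℝ) / 4) : ℝ) : ℂ) =
      ((2 * π * (4 * Δ * x ^ ((1 : ℝ) / 4)) : ℝ) : ℂ) * Complex.I by push_cast; ring]
    exact (Complex.norm_exp_ofReal_mul_I _).le
  · rw [show 2 * T - T = T by ring, abs_of_pos hT, one_mul]

/-- Dyadic majorant for the oscillatory integral. -/
lemma norm_integral_exp_rpow_quarter_le_sum {T Δ : ℝ} (hT : 0 < T) {I : ℕ}
    (hI : Nat.log 2 ⌊|Δ| * T ^ ((1 : ℝ) / 4)⌋₊ + 1 ≤ I) :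
    ‖∫ x in T..(2 * T), Complex.exp (2 * π * Complex.I * ((4 * Δ * x ^ ((1 : ℝ) / 4) : ℝ) : ℂ))‖ ≤
      2 * T * ∑ i ∈ range (I + 1),
        (1 / 2 : ℝ) ^ i * if |Δ| * T ^ ((1 : ℝ) / 4) ≤ 2 ^ i then 1 else 0 := by
  set u := |Δ| * T ^ ((1 : ℝ) / 4) with hu
  have hsum : ∀ i ≤ I, u ≤ 2 ^ i → 2 * T * (1 / 2 : ℝ) ^ i ≤ 2 * T * ∑ i ∈ range (I + 1),
      (1 / 2 : ℝ) ^ i * if u ≤ 2 ^ i then 1 else 0 := by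
    intro i hi hui
    refine mul_le_mul_of_nonneg_left ?_ (by positivity)
    refine le_trans (by rw [if_pos hui, mul_one]) (single_le_sum (f := fun i =>
      (1 / 2 : ℝ) ^ i * if u ≤ 2 ^ i then 1 else 0) (fun j _ => ?_) (mem_range_succ_iff.mpr hi))
    positivity
  rcases le_total u 1 with h1 | h1
  · refine le_trans ?_ (hsum 0 (Nat.zero_le _) (by simpa using h1))
    linarith [norm_integral_exp_rpow_quarter_le_self (Δ := Δ) hT]
  · have hΔ : Δ ≠ 0 := by
      rintro rfl
      rw [hu, abs_zero, zero_mul] at h1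
      linarith
    have hf : ⌊u⌋₊ ≠ 0 := (Nat.floor_pos.mpr h1).ne'
    set l := Nat.log 2 ⌊u⌋₊ with hl
    have hlo : (2 : ℝ) ^ l ≤ u :=
      calc (2 : ℝ) ^ l ≤ ⌊u⌋₊ := by exact_mod_cast Nat.pow_log_le_self 2 hf
        _ ≤ u := Nat.floor_le (by linarith)
    have hhi : u ≤ 2 ^ (l + 1) := by
      refine (Nat.lt_floor_add_one u).le.trans ?_
      exact_mod_cast Nat.lt_pow_succ_log_self (b := 2) (by norm_num) ⌊u⌋₊
    refine le_trans ?_ (hsum (l + 1) hI hhi)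
    refine (norm_integral_exp_rpow_quarter_le hT hΔ).trans ?_
    have h2 : T ^ ((3 : ℝ) / 4) / |Δ| = T / u := by
      have h3 : T = T ^ ((3 : ℝ) / 4) * T ^ ((1 : ℝ) / 4) := by
        rw [← Real.rpow_add hT]; norm_num
      have h4 : 0 < T ^ ((1 : ℝ) / 4) := by positivity
      have h5 : |Δ| ≠ 0 := abs_ne_zero.mpr hΔ
      rw [hu, div_eq_div_iff h5 (by positivity)]
      linear_combination (-|Δ|) * h3
    rw [h2, pow_succ, one_div_pow]
    calc T / u ≤ T / 2 ^ l := by gcongr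
      _ = _ := by ring

/-- The exponential sum with frequencies `4 * (n * x) ^ (1 / 4)` and coefficients `b`. -/
noncomputable def quarterSum (b : ℕ → ℝ) (s : Finset ℕ) (x : ℝ) : ℂ :=
  ∑ n ∈ s, (b n : ℂ) *
    Complex.exp (2 * π * Complex.I * ((4 * ((n : ℝ) * x) ^ ((1 : ℝ) / 4) : ℝ) : ℂ))

lemma continuous_quarterSum (b : ℕ → ℝ) (s : Finset ℕ) : Continuous (quarterSum b s) := by
  have h : ∀ n : ℕ, Continuous fun x : ℝ => ((n : ℝ) * x) ^ ((1 : ℝ) / 4) := fun n =>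
    (Real.continuous_rpow_const (by norm_num)).comp (continuous_const.mul continuous_id)
  unfold quarterSum
  fun_prop

lemma norm_quarterSum_pow_four (b : ℕ → ℝ) (s : Finset ℕ) {x : ℝ} (hx : 0 ≤ x) :
    ((‖quarterSum b s x‖ ^ 4 : ℝ) : ℂ) = ∑ p ∈ Fintype.piFinset fun _ : Fin 4 => s,
      ((∏ i, b (p i) : ℝ) : ℂ) * Complex.exp (2 * π * Complex.I *
        ((4 * quadForm (1 / 4) (fun i => (p i : ℤ)) * x ^ ((1 : ℝ) / 4) : ℝ) : ℂ)) := by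
  set g : Fin 4 → ℕ → ℂ := fun i n => (b n : ℂ) * Complex.exp (2 * π * Complex.I *
    ((quadSign i * (4 * ((n : ℝ) * x) ^ ((1 : ℝ) / 4)) : ℝ) : ℂ)) with hg
  have hS : ∀ i, quadSign i = 1 → ∑ n ∈ s, g i n = quarterSum b s x := by
    intro i hi
    simp only [hg, hi, one_mul, quarterSum]
  have hS' : ∀ i, quadSign i = -1 → ∑ n ∈ s, g i n = starRingEnd ℂ (quarterSum b s x) := by
    intro i hi
    simp only [hg, hi, quarterSum, map_sum, map_mul, Complex.conj_ofReal, ← Complex.exp_conj,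
      Complex.conj_I, map_ofNat]
    refine sum_congr rfl fun n _ => ?_
    congr 2
    push_cast
    ring
  have hprod : ((‖quarterSum b s x‖ ^ 4 : ℝ) : ℂ) = ∏ i, ∑ n ∈ s, g i n := by
    rw [Fin.prod_univ_four, hS 0 (by simp [quadSign]), hS 1 (by simp [quadSign]),
      hS' 2 (by simp [quadSign]), hS' 3 (by simp [quadSign])]
    have := Complex.mul_conj' (quarterSum b s x)
    push_cast
    linear_combination (-(quarterSum b s x * starRingEnd ℂ (quarterSum b s x)) -
      (‖quarterSum b s x‖ : ℂ) ^ 2) * this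
  rw [hprod, prod_univ_sum]
  refine sum_congr rfl fun p _ => ?_
  simp only [hg]
  rw [prod_mul_distrib, ← Complex.exp_sum, ← Complex.ofReal_prod, ← mul_sum, ← Complex.ofReal_sum]
  congr 5
  simp only [quadForm, mul_sum, sum_mul]
  refine sum_congr rfl fun i _ => ?_
  rw [Real.mul_rpow (Nat.cast_nonneg _) hx]
  push_cast
  ring

lemma integral_norm_quarterSum_pow_four_le (b : ℕ → ℝ) (s : Finset ℕ) {T B : ℝ} (hT : 0 < T)
    (hB : ∀ n ∈ s, |b n| ≤ B) :
    ∫ x in T..(2 * T), ‖quarterSum b s x‖ ^ 4 ≤ ∑ p ∈ Fintype.piFinset fun _ : Fin 4 => s, B ^ 4 *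
      ‖∫ x in T..(2 * T), Complex.exp (2 * π * Complex.I *
        ((4 * quadForm (1 / 4) (fun i => (p i : ℤ)) * x ^ ((1 : ℝ) / 4) : ℝ) : ℂ))‖ := by
  have hcont : Continuous fun x : ℝ => x ^ ((1 : ℝ) / 4) := Real.continuous_rpow_const (by norm_num)
  have h1 : ((∫ x in T..(2 * T), ‖quarterSum b s x‖ ^ 4 : ℝ) : ℂ) =
      ∑ p ∈ Fintype.piFinset fun _ : Fin 4 => s, ((∏ i, b (p i) : ℝ) : ℂ) *
        ∫ x in T..(2 * T), Complex.exp (2 * π * Complex.I *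
          ((4 * quadForm (1 / 4) (fun i => (p i : ℤ)) * x ^ ((1 : ℝ) / 4) : ℝ) : ℂ)) := by
    rw [← intervalIntegral.integral_ofReal]
    have : Set.EqOn (fun x => ((‖quarterSum b s x‖ ^ 4 : ℝ) : ℂ)) _ (Set.uIcc T (2 * T)) :=
      fun x hx => norm_quarterSum_pow_four b s (by
        rw [Set.uIcc_of_le (by linarith)] at hx
        linarith [hx.1])
    rw [intervalIntegral.integral_congr this, intervalIntegral.integral_finsetSum]
    · simp only [intervalIntegral.integral_const_mul]
    · intro p _
      refine Continuous.intervalIntegrable ?_ _ _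
      fun_prop
  have h2 : ∫ x in T..(2 * T), ‖quarterSum b s x‖ ^ 4 ≤
      ‖((∫ x in T..(2 * T), ‖quarterSum b s x‖ ^ 4 : ℝ) : ℂ)‖ := by
    rw [Complex.norm_real]
    exact le_abs_self _
  refine h2.trans ?_
  rw [h1]
  refine (norm_sum_le _ _).trans (sum_le_sum fun p hp => ?_)
  rw [norm_mul, Complex.norm_real, Real.norm_eq_abs, abs_prod]
  gcongr
  calc ∏ i, |b (p i)| ≤ ∏ _i : Fin 4, B :=
        prod_le_prod (fun _ _ => abs_nonneg _) fun i _ => hB _ (Fintype.mem_piFinset.mp hp i)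
    _ = B ^ 4 := by simp

/-- Fourth moment bound over a dyadic block. -/
lemma exists_fourth_moment_dyadic {ε : ℝ} (hε : 0 < ε) :
    ∃ C : ℝ, 0 < C ∧ ∀ (T N B : ℝ) (b : ℕ → ℝ) (s : Finset ℕ), 1 ≤ N → N ≤ T →
      (∀ n ∈ s, N ≤ n ∧ (n : ℝ) ≤ 2 * N) → (∀ n ∈ s, |b n| ≤ B) →
      ∫ x in T..(2 * T), ‖quarterSum b s x‖ ^ 4 ≤
        C * (Nat.log 2 ⌊8 * T⌋₊ + 2 : ℕ) * T * B ^ 4 *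
          (T ^ (-(1 : ℝ) / 4) * N ^ ((15 : ℝ) / 4) + N ^ (2 + ε)) := by
  classical
  obtain ⟨C, hC, H⟩ := exists_card_nearSol_le (α := 1 / 4) (lam := 2) (by norm_num) (by norm_num)
    (by norm_num) hε
  refine ⟨2 * C, by positivity, fun T N B b s hN hNT hs hB => ?_⟩
  have hN0 : 0 < N := by linarith
  have hT1 : 1 ≤ T := by linarith
  have hT : 0 < T := by linarith
  refine (integral_norm_quarterSum_pow_four_le b s hT hB).trans ?_
  set P := Fintype.piFinset fun _ : Fin 4 => s with hP
  set I := Nat.log 2 ⌊8 * T⌋₊ + 1 with hI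
  set Δ : (Fin 4 → ℕ) → ℝ := fun p => quadForm (1 / 4) fun i => (p i : ℤ) with hΔ
  have hT4 : 0 < T ^ ((1 : ℝ) / 4) := by positivity
  have hT4' : T ^ (-(1 : ℝ) / 4) = (T ^ ((1 : ℝ) / 4))⁻¹ := by
    rw [← Real.rpow_neg hT.le]; norm_num
  have hps : ∀ p ∈ P, ∀ i, N ≤ p i ∧ (p i : ℝ) ≤ 2 * N := fun p hp i =>
    hs _ (Fintype.mem_piFinset.mp hp i)
  have hΔb : ∀ p ∈ P, |Δ p| * T ^ ((1 : ℝ) / 4) ≤ 8 * T := by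
    intro p hp
    have h1 : |Δ p| ≤ ∑ _i : Fin 4, 2 * T ^ ((1 : ℝ) / 4) := by
      refine (abs_sum_le_sum_abs _ _).trans (sum_le_sum fun i _ => ?_)
      rw [abs_mul, abs_quadSign, one_mul, Int.cast_natCast, abs_of_nonneg (by positivity)]
      calc (p i : ℝ) ^ ((1 : ℝ) / 4) ≤ (16 * T) ^ ((1 : ℝ) / 4) := by
            gcongr
            linarith [(hps p hp i).2]
        _ = _ := by
            rw [Real.mul_rpow (by norm_num) hT.le, show (16 : ℝ) = 2 ^ (4 : ℝ) by norm_num,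
              ← Real.rpow_mul (by norm_num)]
            norm_num
    rw [sum_const, card_univ, Fintype.card_fin, nsmul_eq_mul] at h1
    calc |Δ p| * T ^ ((1 : ℝ) / 4) ≤ 8 * (T ^ ((1 : ℝ) / 4) * T ^ ((1 : ℝ) / 4)) := by
          have := mul_le_mul_of_nonneg_right h1 hT4.le
          push_cast at this
          linarith
      _ ≤ 8 * T := by
          rw [← Real.rpow_add hT]
          gcongr
          calc T ^ ((1 : ℝ) / 4 + 1 / 4) ≤ T ^ (1 : ℝ) :=
                Real.rpow_le_rpow_of_exponent_le hT1 (by norm_num)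
            _ = T := Real.rpow_one T
  have hcount : ∀ i : ℕ, (#(P.filter fun p => |Δ p| * T ^ ((1 : ℝ) / 4) ≤ 2 ^ i) : ℝ) ≤
      2 ^ i * (C * (T ^ (-(1 : ℝ) / 4) * N ^ ((15 : ℝ) / 4) + N ^ (2 + ε))) := by
    intro i
    have h1 : #(P.filter fun p => |Δ p| * T ^ ((1 : ℝ) / 4) ≤ 2 ^ i) ≤
        #(nearSol (1 / 4) 2 (2 ^ i * T ^ (-(1 : ℝ) / 4) * N ^ (-(1 : ℝ) / 4)) N) := by
      refine card_le_card_of_injOn (fun p i => (p i : ℤ)) ?_ ?_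
      · intro p hp
        obtain ⟨hpP, hpi⟩ := mem_filter.mp hp
        rw [mem_coe, mem_nearSol (by norm_num) hN0]
        refine ⟨fun j => ?_, ?_⟩
        · have := hps p hpP j
          push_cast
          constructor <;> linarith
        · have h3 : N ^ (-(1 : ℝ) / 4) * N ^ ((1 : ℝ) / 4) = 1 := by
            rw [← Real.rpow_add hN0]; norm_num
          rw [mul_assoc, h3, mul_one, hT4', ← div_eq_mul_inv, le_div_iff₀ hT4]
          exact hpi
      · intro p _ q _ h
        funext i
        exact Int.ofNat_inj.mp (congrFun h i)
    have h2 := H N (2 ^ i * T ^ (-(1 : ℝ) / 4) * N ^ (-(1 : ℝ) / 4)) hN (by positivity)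
    have h3 : N ^ (-(1 : ℝ) / 4) * N ^ 4 = N ^ ((15 : ℝ) / 4) := by
      rw [← Real.rpow_natCast, ← Real.rpow_add hN0]; norm_num
    calc _ ≤ (#(nearSol (1 / 4) 2 (2 ^ i * T ^ (-(1 : ℝ) / 4) * N ^ (-(1 : ℝ) / 4)) N) : ℝ) := by
          exact_mod_cast h1
      _ ≤ C * (2 ^ i * T ^ (-(1 : ℝ) / 4) * N ^ (-(1 : ℝ) / 4) * N ^ 4 + 1 * N ^ (2 + ε)) := by
          rw [one_mul]; exact h2
      _ ≤ C * (2 ^ i * T ^ (-(1 : ℝ) / 4) * N ^ (-(1 : ℝ) / 4) * N ^ 4 + 2 ^ i * N ^ (2 + ε)) := by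
          gcongr
          exact one_le_pow₀ (by norm_num)
      _ = _ := by rw [mul_assoc _ (N ^ (-(1 : ℝ) / 4)), h3]; ring
  set W := C * (T ^ (-(1 : ℝ) / 4) * N ^ ((15 : ℝ) / 4) + N ^ (2 + ε)) with hW
  have hterm : ∀ p ∈ P, B ^ 4 * ‖∫ x in T..(2 * T), Complex.exp (2 * π * Complex.I *
      ((4 * Δ p * x ^ ((1 : ℝ) / 4) : ℝ) : ℂ))‖ ≤
      B ^ 4 * (2 * T * ∑ i ∈ range (I + 1),
        (1 / 2 : ℝ) ^ i * if |Δ p| * T ^ ((1 : ℝ) / 4) ≤ 2 ^ i then 1 else 0) := by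
    intro p hp
    have h4 : (0 : ℝ) ≤ B ^ 4 := by positivity
    refine mul_le_mul_of_nonneg_left (norm_integral_exp_rpow_quarter_le_sum hT ?_) h4
    exact Nat.add_le_add_right (Nat.log_mono_right (Nat.floor_mono (hΔb p hp))) 1
  refine (sum_le_sum hterm).trans ?_
  rw [← mul_sum, ← mul_sum, sum_comm]
  have hinner : ∀ i ∈ range (I + 1), ∑ p ∈ P, (1 / 2 : ℝ) ^ i *
      (if |Δ p| * T ^ ((1 : ℝ) / 4) ≤ 2 ^ i then 1 else 0) ≤ W := by
    intro i _
    rw [← mul_sum, sum_boole]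
    calc _ ≤ (1 / 2 : ℝ) ^ i * (2 ^ i * W) := by
          gcongr
          exact hcount i
      _ = W := by rw [← mul_assoc, ← mul_pow]; norm_num
  calc _ ≤ B ^ 4 * (2 * T * ∑ i ∈ range (I + 1), W) := by
        gcongr with i hi
        exact hinner i hi
    _ = _ := by
        rw [sum_const, card_range, nsmul_eq_mul, hW, hI]
        push_cast
        ring

lemma exists_log_two_floor_le {δ : ℝ} (hδ : 0 < δ) :
    ∃ C : ℝ, 0 < C ∧ ∀ T : ℝ, 1 ≤ T → ((Nat.log 2 ⌊8 * T⌋₊ + 2 : ℕ) : ℝ) ≤ C * T ^ δ := by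
  refine ⟨8 ^ δ / δ / Real.log 2 + 2, by positivity, fun T hT => ?_⟩
  have hT0 : 0 < T := by linarith
  have hTδ : 1 ≤ T ^ δ := Real.one_le_rpow hT hδ.le
  have hlog2 : 0 < Real.log 2 := Real.log_pos (by norm_num)
  have hn : ⌊8 * T⌋₊ ≠ 0 := (Nat.floor_pos.mpr (by linarith)).ne'
  have h1 : (2 : ℝ) ^ Nat.log 2 ⌊8 * T⌋₊ ≤ 8 * T :=
    calc (2 : ℝ) ^ Nat.log 2 ⌊8 * T⌋₊ ≤ ⌊8 * T⌋₊ := by exact_mod_cast Nat.pow_log_le_self 2 hn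
      _ ≤ 8 * T := Nat.floor_le (by positivity)
  have h2 : (Nat.log 2 ⌊8 * T⌋₊ : ℝ) * Real.log 2 ≤ Real.log (8 * T) := by
    rw [← Real.log_pow]
    exact Real.log_le_log (by positivity) h1
  have h3 : Real.log (8 * T) ≤ 8 ^ δ / δ * T ^ δ := by
    refine (Real.log_le_rpow_div (by positivity) hδ).trans (le_of_eq ?_)
    rw [Real.mul_rpow (by norm_num) hT0.le]
    ring
  have h4 : (Nat.log 2 ⌊8 * T⌋₊ : ℝ) ≤ 8 ^ δ / δ / Real.log 2 * T ^ δ := by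
    rw [← le_div_iff₀ hlog2] at h2
    calc _ ≤ 8 ^ δ / δ * T ^ δ / Real.log 2 := h2.trans (by gcongr)
      _ = _ := by ring
  push_cast
  linarith

lemma norm_sum_pow_four_le {I : ℕ} (f : ℕ → ℂ) :
    ‖∑ i ∈ range I, f i‖ ^ 4 ≤ (I : ℝ) ^ 3 * ∑ i ∈ range I, ‖f i‖ ^ 4 := by
  calc ‖∑ i ∈ range I, f i‖ ^ 4 ≤ (∑ i ∈ range I, ‖f i‖) ^ 4 := by
        gcongr
        exact norm_sum_le _ _
    _ ≤ _ := by
        simpa using pow_sum_le_card_mul_sum_pow (s := range I) (f := fun i => ‖f i‖)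
          (fun i _ => norm_nonneg _) 3

theorem stmt_5 (c : ℕ → ℝ) (hc0 : ∀ n, 0 ≤ c n)
    (hc : ∀ ε : ℝ, 0 < ε → ∃ K : ℝ, 0 < K ∧ ∀ n : ℕ, 1 ≤ n → c n ≤ K * (n : ℝ) ^ ε)
    (ε : ℝ) (hε : 0 < ε) :
    ∃ C : ℝ, 0 < C ∧ ∀ T y : ℝ, 10 ≤ T → 1 ≤ y → y ≤ T ^ ((1 : ℝ) / 12) →
      (∫ x in T..(2 * T),
          ‖∑ n ∈ Finset.Ioc ⌊y⌋₊ ⌊T ^ ((1 : ℝ) / 2)⌋₊,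
              ((c n / (n : ℝ) ^ ((7 : ℝ) / 8) : ℝ) : ℂ) *
                Complex.exp (2 * π * Complex.I * ((4 * ((n : ℝ) * x) ^ ((1 : ℝ) / 4) : ℝ) : ℂ))‖ ^ 4) ≤
        C * T ^ (1 + ε) * y ^ (-(3 : ℝ) / 2) := by
  set δ : ℝ := min (ε / 10) (1 / 10) with hδ
  have hδ0 : 0 < δ := lt_min (by positivity) (by norm_num)
  have hδε : 10 * δ ≤ ε := by linarith [min_le_left (ε / 10) (1 / 10)]
  have hδ1 : δ ≤ 1 / 10 := min_le_right _ _
  obtain ⟨K, hK, hKc⟩ := hc δ hδ0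
  obtain ⟨C, hC, H⟩ := exists_fourth_moment_dyadic hδ0
  obtain ⟨C', hC', H'⟩ := exists_log_two_floor_le hδ0
  refine ⟨C' ^ 5 * (C * (K ^ 4 * 5)), by positivity, fun T y hT hy hyT => ?_⟩
  have hT0 : 0 < T := by linarith
  have hT1 : 1 ≤ T := by linarith
  have hy0 : 0 < y := by linarith
  set b : ℕ → ℝ := fun n => c n / (n : ℝ) ^ ((7 : ℝ) / 8) with hb
  set s := Finset.Ioc ⌊y⌋₊ ⌊T ^ ((1 : ℝ) / 2)⌋₊ with hs
  set L := Nat.log 2 ⌊8 * T⌋₊ + 2 with hL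
  change ∫ x in T..(2 * T), ‖quarterSum b s x‖ ^ 4 ≤ _
  have hsT : ∀ n ∈ s, y ≤ n ∧ (n : ℝ) ≤ T ^ ((1 : ℝ) / 2) := by
    intro n hn
    obtain ⟨h1, h2⟩ := Finset.mem_Ioc.mp hn
    exact ⟨(Nat.lt_of_floor_lt h1).le, (Nat.le_floor_iff (by positivity)).mp h2⟩
  have hsqrtT : T ^ ((1 : ℝ) / 2) ≤ T := by
    calc T ^ ((1 : ℝ) / 2) ≤ T ^ (1 : ℝ) := Real.rpow_le_rpow_of_exponent_le hT1 (by norm_num)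
      _ = T := Real.rpow_one T
  have hmaps : ∀ n ∈ s, Nat.log 2 n ∈ range L := by
    intro n hn
    rw [mem_range, hL]
    have : Nat.log 2 n ≤ Nat.log 2 ⌊8 * T⌋₊ :=
      Nat.log_mono_right (Nat.le_floor (by linarith [(hsT n hn).2]))
    omega
  set t : ℕ → Finset ℕ := fun i => s.filter fun n => Nat.log 2 n = i with ht
  have hsplit : ∀ x, quarterSum b s x = ∑ i ∈ range L, quarterSum b (t i) x := fun x =>
    (sum_fiberwise_of_maps_to hmaps _).symm
  have hblock : ∀ i, ∫ x in T..(2 * T), ‖quarterSum b (t i) x‖ ^ 4 ≤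
      C * L * (K ^ 4 * 5) * (T ^ (1 + 5 * δ) * y ^ (-(3 : ℝ) / 2)) := by
    intro i
    rcases (t i).eq_empty_or_nonempty with h0 | ⟨n₀, hn₀⟩
    · simp only [h0, quarterSum, sum_empty, norm_zero]
      rw [zero_pow (by norm_num), intervalIntegral.integral_zero]
      positivity
    set N : ℝ := 2 ^ i with hN
    have hN1 : 1 ≤ N := one_le_pow₀ (by norm_num)
    have hN0 : 0 < N := by linarith
    have htN : ∀ n ∈ t i, N ≤ n ∧ (n : ℝ) ≤ 2 * N := by
      intro n hn
      obtain ⟨hns, rfl⟩ := mem_filter.mp hn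
      have hn0 : n ≠ 0 := by
        rintro rfl
        have := (hsT 0 hns).1
        simp only [Nat.cast_zero] at this
        linarith
      constructor
      · rw [hN]; exact_mod_cast Nat.pow_log_le_self 2 hn0
      · have := (Nat.lt_pow_succ_log_self (b := 2) (by norm_num) n).le
        rw [pow_succ'] at this
        rw [hN]; exact_mod_cast this
    have hNT : N ≤ T ^ ((1 : ℝ) / 2) :=
      (htN n₀ hn₀).1.trans (hsT n₀ (mem_filter.mp hn₀).1).2
    have hyN : y / 2 ≤ N := by
      linarith [(htN n₀ hn₀).2, (hsT n₀ (mem_filter.mp hn₀).1).1]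
    have hbB : ∀ n ∈ t i, |b n| ≤ K * N ^ (δ - 7 / 8) := by
      intro n hn
      have hNn := (htN n hn).1
      have hn0 : (0 : ℝ) < n := hN0.trans_le hNn
      have hn1 : 1 ≤ n := by exact_mod_cast hN1.trans hNn
      rw [hb, abs_of_nonneg (div_nonneg (hc0 n) (by positivity))]
      calc c n / (n : ℝ) ^ ((7 : ℝ) / 8) ≤ K * (n : ℝ) ^ δ / (n : ℝ) ^ ((7 : ℝ) / 8) := by
            gcongr
            exact hKc n hn1
        _ = K * (n : ℝ) ^ (δ - 7 / 8) := by rw [Real.rpow_sub hn0, mul_div_assoc]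
        _ ≤ K * N ^ (δ - 7 / 8) := by
            exact mul_le_mul_of_nonneg_left
              (Real.rpow_le_rpow_of_nonpos hN0 hNn (by linarith)) hK.le
    refine (H T N _ b (t i) hN1 (hNT.trans hsqrtT) htN hbB).trans ?_
    have hNδ : N ^ (5 * δ) ≤ T ^ (5 * δ) :=
      Real.rpow_le_rpow hN0.le (hNT.trans hsqrtT) (by positivity)
    have h1 : (N ^ (δ - 7 / 8)) ^ 4 * N ^ (2 + δ) = N ^ (5 * δ) * N ^ (-(3 : ℝ) / 2) := by
      rw [← Real.rpow_mul_natCast hN0.le, ← Real.rpow_add hN0, ← Real.rpow_add hN0]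
      congr 1
      push_cast
      ring
    have h2 : (N ^ (δ - 7 / 8)) ^ 4 * N ^ ((15 : ℝ) / 4) ≤ N ^ (5 * δ) * N ^ ((1 : ℝ) / 4) := by
      rw [← Real.rpow_mul_natCast hN0.le, ← Real.rpow_add hN0, ← Real.rpow_add hN0]
      refine Real.rpow_le_rpow_of_exponent_le hN1 ?_
      push_cast
      linarith
    have h3 : N ^ (-(3 : ℝ) / 2) ≤ 4 * y ^ (-(3 : ℝ) / 2) := by
      calc N ^ (-(3 : ℝ) / 2) ≤ (y / 2) ^ (-(3 : ℝ) / 2) :=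
            Real.rpow_le_rpow_of_nonpos (by positivity) hyN (by norm_num)
        _ = 2 ^ ((3 : ℝ) / 2) * y ^ (-(3 : ℝ) / 2) := by
            rw [Real.div_rpow hy0.le (by norm_num), neg_div,
              Real.rpow_neg (by norm_num : (0 : ℝ) ≤ 2), div_inv_eq_mul, mul_comm]
        _ ≤ 2 ^ (2 : ℝ) * y ^ (-(3 : ℝ) / 2) := by
            gcongr
            · norm_num
            · norm_num
        _ = _ := by norm_num
    have h4 : T ^ (-(1 : ℝ) / 4) * N ^ ((1 : ℝ) / 4) ≤ y ^ (-(3 : ℝ) / 2) := by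
      calc T ^ (-(1 : ℝ) / 4) * N ^ ((1 : ℝ) / 4) ≤
            T ^ (-(1 : ℝ) / 4) * (T ^ ((1 : ℝ) / 2)) ^ ((1 : ℝ) / 4) := by gcongr
        _ = (T ^ ((1 : ℝ) / 12)) ^ (-(3 : ℝ) / 2) := by
            rw [← Real.rpow_mul hT0.le, ← Real.rpow_mul hT0.le, ← Real.rpow_add hT0]
            norm_num
        _ ≤ _ := Real.rpow_le_rpow_of_nonpos hy0 hyT (by norm_num)
    have h5 : (N ^ (δ - 7 / 8)) ^ 4 * (T ^ (-(1 : ℝ) / 4) * N ^ ((15 : ℝ) / 4) + N ^ (2 + δ)) ≤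
        T ^ (5 * δ) * (5 * y ^ (-(3 : ℝ) / 2)) := by
      calc _ = T ^ (-(1 : ℝ) / 4) * ((N ^ (δ - 7 / 8)) ^ 4 * N ^ ((15 : ℝ) / 4)) +
              (N ^ (δ - 7 / 8)) ^ 4 * N ^ (2 + δ) := by ring
        _ ≤ T ^ (-(1 : ℝ) / 4) * (N ^ (5 * δ) * N ^ ((1 : ℝ) / 4)) +
              N ^ (5 * δ) * N ^ (-(3 : ℝ) / 2) := by
            rw [h1]
            gcongr
        _ = N ^ (5 * δ) * (T ^ (-(1 : ℝ) / 4) * N ^ ((1 : ℝ) / 4) + N ^ (-(3 : ℝ) / 2)) := by ring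
        _ ≤ T ^ (5 * δ) * (y ^ (-(3 : ℝ) / 2) + 4 * y ^ (-(3 : ℝ) / 2)) := by gcongr
        _ = _ := by ring
    calc C * (L : ℝ) * T * (K * N ^ (δ - 7 / 8)) ^ 4 *
          (T ^ (-(1 : ℝ) / 4) * N ^ ((15 : ℝ) / 4) + N ^ (2 + δ)) =
        C * L * K ^ 4 * T * ((N ^ (δ - 7 / 8)) ^ 4 *
          (T ^ (-(1 : ℝ) / 4) * N ^ ((15 : ℝ) / 4) + N ^ (2 + δ))) := by ring
      _ ≤ C * L * K ^ 4 * T * (T ^ (5 * δ) * (5 * y ^ (-(3 : ℝ) / 2))) := by gcongr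
      _ = _ := by
          rw [Real.rpow_add hT0, Real.rpow_one]
          ring
  have hint : ∀ u : Finset ℕ, IntervalIntegrable (fun x => ‖quarterSum b u x‖ ^ 4)
      MeasureTheory.volume T (2 * T) := fun u =>
    ((continuous_quarterSum b u).norm.pow 4).intervalIntegrable _ _
  calc ∫ x in T..(2 * T), ‖quarterSum b s x‖ ^ 4 ≤
        ∫ x in T..(2 * T), (L : ℝ) ^ 3 * ∑ i ∈ range L, ‖quarterSum b (t i) x‖ ^ 4 := by
        refine intervalIntegral.integral_mono_on (by linarith) (hint s)
          ((continuous_const.mul (continuous_finsetSum _ fun i _ =>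
            (continuous_quarterSum b (t i)).norm.pow 4)).intervalIntegrable _ _) fun x _ => ?_
        rw [hsplit]
        exact norm_sum_pow_four_le _
    _ = (L : ℝ) ^ 3 * ∑ i ∈ range L, ∫ x in T..(2 * T), ‖quarterSum b (t i) x‖ ^ 4 := by
        rw [intervalIntegral.integral_const_mul,
          intervalIntegral.integral_finsetSum fun i _ => hint (t i)]
    _ ≤ (L : ℝ) ^ 3 * ∑ _i ∈ range L,
          C * L * (K ^ 4 * 5) * (T ^ (1 + 5 * δ) * y ^ (-(3 : ℝ) / 2)) := by
        gcongr with i _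
        exact hblock i
    _ = (L : ℝ) ^ 5 * (C * (K ^ 4 * 5)) * (T ^ (1 + 5 * δ) * y ^ (-(3 : ℝ) / 2)) := by
        rw [sum_const, card_range, nsmul_eq_mul]
        ring
    _ ≤ (C' * T ^ δ) ^ 5 * (C * (K ^ 4 * 5)) * (T ^ (1 + 5 * δ) * y ^ (-(3 : ℝ) / 2)) := by
        gcongr
        exact H' T hT1
    _ = C' ^ 5 * (C * (K ^ 4 * 5)) * T ^ (1 + 10 * δ) * y ^ (-(3 : ℝ) / 2) := by
        have : (T ^ δ) ^ 5 * T ^ (1 + 5 * δ) = T ^ (1 + 10 * δ) := by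
          rw [← Real.rpow_mul_natCast hT0.le, ← Real.rpow_add hT0]
          congr 1
          push_cast
          ring
        rw [mul_pow, ← this]
        ring
    _ ≤ _ := by gcongr
end

section
/- Let k ∈ {3,4,5}. For each l with 1 ≤ l ≤ k−1, the series s_{k;l}(c) = ∑ c_{n₁}⋯c_{n_k}/(n₁⋯n_k)^{7/8}, taken over all k-tuples (n₁,…,n_k) of positive integers satisfying n₁^{1/4} + ⋯ + n_l^{1/4} = n_{l+1}^{1/4} + ⋯ + n_k^{1/4}, converges absolutely. -/
open Real Finset

/-- An irrational real radical of a rational number has a minimal polynomial of the form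
`X ^ e - r` with `2 ≤ e`, so the second leading coefficient of that polynomial vanishes. -/
theorem minpoly_nextCoeff_eq_zero_of_pow_eq_ratCast {x : ℝ} (hx : Irrational x) {d : ℕ}
    (hd : d ≠ 0) {q : ℚ} (hxq : x ^ d = q) : (minpoly ℚ x).nextCoeff = 0 := by
  have hint : IsIntegral ℚ x :=
    IsIntegral.of_pow (Nat.pos_of_ne_zero hd) (hxq ▸ isIntegral_algebraMap (R := ℚ) (x := q))
  set p := minpoly ℚ x with hp
  set e := p.natDegree with he
  have hmonic : p.Monic := minpoly.monic hint
  have hpos : 0 < e := minpoly.natDegree_pos hint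
  have hdvd : p ∣ Polynomial.X ^ d - Polynomial.C q :=
    minpoly.dvd _ _ (by simp [hxq])
  have hroot : ∀ z ∈ (p.map (algebraMap ℚ ℂ)).roots, ‖z‖ = |x| := by
    intro z hz
    have hz0 : Polynomial.aeval z p = 0 := by
      rw [Polynomial.aeval_def, ← Polynomial.eval_map]
      exact Polynomial.isRoot_of_mem_roots hz
    have hzd : z ^ d = (q : ℂ) := by
      have := Polynomial.aeval_eq_zero_of_dvd_aeval_eq_zero hdvd hz0
      simpa [sub_eq_zero] using this
    have hxz : z ^ d = (x : ℂ) ^ d := by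
      rw [hzd]; exact_mod_cast congrArg (Complex.ofReal) hxq.symm
    have hn : ‖z‖ ^ d = |x| ^ d := by
      have := congrArg norm hxz
      simpa using this
    exact (pow_left_inj₀ (norm_nonneg _) (abs_nonneg _) hd).1 hn
  have hsplits : (p.map (algebraMap ℚ ℂ)).Splits := IsAlgClosed.splits _
  have hcoeff : |(p.coeff 0 : ℝ)| = |x| ^ e := by
    have h0 := hsplits.coeff_zero_eq_prod_roots_of_monic (hmonic.map _)
    have hcard : (p.map (algebraMap ℚ ℂ)).roots.card = e := by
      rw [← hsplits.natDegree_eq_card_roots, Polynomial.natDegree_map]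
    have h1 := congrArg norm h0
    have hprod : ‖(p.map (algebraMap ℚ ℂ)).roots.prod‖ = |x| ^ e := by
      rw [← hcard, ← Multiset.prod_replicate, ← Multiset.map_const', ← normHom_apply,
        map_multiset_prod]
      exact congrArg _ (Multiset.map_congr rfl hroot)
    rw [norm_mul, hprod, norm_pow, norm_neg, norm_one, one_pow, one_mul,
      Polynomial.coeff_map] at h1
    rw [← h1]
    simp
  obtain ⟨r, hr⟩ : ∃ r : ℚ, x ^ e = r := by
    rw [← abs_pow, abs_eq_abs] at hcoeff
    rcases hcoeff with h | h
    · exact ⟨_, h.symm⟩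
    · exact ⟨-p.coeff 0, by rw [Rat.cast_neg, h, neg_neg]⟩
  have hpe : Polynomial.X ^ e - Polynomial.C r = p := by
    refine minpoly.unique_of_degree_le_degree_minpoly ℚ x
      (Polynomial.monic_X_pow_sub_C r hpos.ne') (by simp [hr]) ?_
    rw [Polynomial.degree_X_pow_sub_C hpos, ← hp, Polynomial.degree_eq_natDegree hmonic.ne_zero]
  have he1 : e ≠ 1 := fun h => hx ⟨r, by rw [← hr, h, pow_one]⟩
  rw [Polynomial.nextCoeff_of_natDegree_pos hpos, ← hpe]
  simp only [Polynomial.natDegree_X_pow_sub_C, Polynomial.coeff_sub, Polynomial.coeff_X_pow,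
    Polynomial.coeff_C]
  rw [if_neg (by omega), if_neg (by omega), sub_zero]

/-- In a vanishing sum of real radicals of rational numbers, no nonzero term is
incommensurable with all the others. -/
theorem exists_ne_div_eq_ratCast_of_sum_eq_zero {ι : Type*} [Fintype ι] {x : ι → ℝ} {d : ℕ}
    (hd : d ≠ 0) (hx : ∀ i, ∃ q : ℚ, x i ^ d = q) (hsum : ∑ i, x i = 0) {j : ι}
    (hj : x j ≠ 0) : ∃ i ≠ j, ∃ q : ℚ, x i / x j = q := by
  by_contra! hcon
  let y : ι → ℝ := fun i => x i / x j
  have hy : ∀ i, ∃ q : ℚ, y i ^ d = q := fun i => by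
    obtain ⟨a, ha⟩ := hx i
    obtain ⟨b, hb⟩ := hx j
    exact ⟨a / b, by simp [y, div_pow, ha, hb]⟩
  have hyint : ∀ z ∈ Set.range y, IsIntegral ℚ z := by
    rintro _ ⟨i, rfl⟩
    obtain ⟨q, hq⟩ := hy i
    exact IsIntegral.of_pow (Nat.pos_of_ne_zero hd)
      (hq ▸ isIntegral_algebraMap (R := ℚ) (x := q))
  let L := IntermediateField.adjoin ℚ (Set.range y)
  have : FiniteDimensional ℚ L := IntermediateField.finiteDimensional_adjoin hyint
  let w : ι → L := fun i => ⟨y i, IntermediateField.subset_adjoin ℚ _ ⟨i, rfl⟩⟩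
  have hw : ∑ i, w i = 0 := by
    apply Subtype.ext
    simp [w, y, ← Finset.sum_div, hsum]
  have htr : ∀ i ≠ j, Algebra.trace ℚ L (w i) = 0 := fun i hi => by
    obtain ⟨q, hq⟩ := hy i
    have hirr : Irrational (y i) := by
      rintro ⟨r, hr⟩
      exact hcon i hi r hr.symm
    have := minpoly_nextCoeff_eq_zero_of_pow_eq_ratCast hirr hd hq
    rw [trace_eq_finrank_mul_minpoly_nextCoeff, ← minpoly.algebraMap_eq (B' := ℝ) Subtype.val_injective (w i)]
    exact mul_eq_zero_of_right _ (neg_eq_zero.2 this)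
  have hwj : w j = 1 := Subtype.ext (div_self hj)
  have h0 := congrArg (Algebra.trace ℚ L) hw
  rw [map_sum, map_zero, Finset.sum_eq_single j (fun i _ => htr i) (by simp), hwj,
    ← map_one (algebraMap ℚ L), Algebra.trace_algebraMap] at h0
  simp [Module.finrank_pos.ne'] at h0

/-- The least positive integer which differs from `n` by a rational `d`-th power factor. -/
noncomputable def powFreePart (d n : ℕ) : ℕ :=
  sInf {m | 0 < m ∧ ∃ a b : ℕ, 0 < a ∧ 0 < b ∧ m * a ^ d = n * b ^ d}

theorem powFreePart_mem (d : ℕ) {n : ℕ} (hn : 0 < n) :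
    0 < powFreePart d n ∧
      ∃ a b : ℕ, 0 < a ∧ 0 < b ∧ powFreePart d n * a ^ d = n * b ^ d :=
  Nat.sInf_mem (s := {m | 0 < m ∧ ∃ a b : ℕ, 0 < a ∧ 0 < b ∧ m * a ^ d = n * b ^ d})
    ⟨n, hn, 1, 1, one_pos, one_pos, rfl⟩

theorem exists_eq_powFreePart_mul_pow (d : ℕ) {n : ℕ} (hn : 0 < n) :
    ∃ h : ℕ, 0 < h ∧ n = powFreePart d n * h ^ d := by
  obtain ⟨hm, a, b, ha, hb, hab⟩ := powFreePart_mem d hn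
  set m := powFreePart d n with hmdef
  obtain ⟨g, a', b', hg, hcop, rfl, rfl⟩ := Nat.exists_coprime' (Nat.gcd_pos_of_pos_left b ha)
  have ha' : 0 < a' := Nat.pos_of_mul_pos_right ha
  have hb' : 0 < b' := Nat.pos_of_mul_pos_right hb
  have hab' : m * a' ^ d = n * b' ^ d := by
    have hgd : 0 < g ^ d := by positivity
    apply Nat.eq_of_mul_eq_mul_right hgd
    simpa [mul_pow, mul_assoc] using hab
  obtain ⟨t, ht⟩ : b' ^ d ∣ m :=
    (Nat.Coprime.pow d d hcop.symm).dvd_of_dvd_mul_right ⟨n, by rw [hab', mul_comm]⟩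
  have hb0 : 0 < b' ^ d := by positivity
  have hnt : n = t * a' ^ d := by
    apply Nat.eq_of_mul_eq_mul_right hb0
    rw [← hab', ht]; ring
  have ht0 : 0 < t := Nat.pos_of_ne_zero (by rintro rfl; simp at ht; omega)
  have hle : m ≤ t := Nat.sInf_le ⟨ht0, a', 1, ha', one_pos, by rw [hnt]; ring⟩
  have htm : m = t := le_antisymm hle (ht ▸ Nat.le_mul_of_pos_left t hb0)
  exact ⟨a', ha', htm ▸ hnt⟩

theorem powFreePart_eq_of_mul_pow_eq {d n n' a b : ℕ} (ha : 0 < a) (hb : 0 < b)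
    (h : n * a ^ d = n' * b ^ d) : powFreePart d n = powFreePart d n' := by
  have key : ∀ {n n' a b : ℕ}, 0 < a → 0 < b → n * a ^ d = n' * b ^ d → ∀ m,
      (∃ u v : ℕ, 0 < u ∧ 0 < v ∧ m * u ^ d = n * v ^ d) →
      ∃ u v : ℕ, 0 < u ∧ 0 < v ∧ m * u ^ d = n' * v ^ d := by
    rintro n n' a b ha hb h m ⟨u, v, hu, hv, huv⟩
    refine ⟨u * a, v * b, Nat.mul_pos hu ha, Nat.mul_pos hv hb, ?_⟩
    calc m * (u * a) ^ d = (m * u ^ d) * a ^ d := by ring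
      _ = (n * a ^ d) * v ^ d := by rw [huv]; ring
      _ = n' * (v * b) ^ d := by rw [h]; ring
  unfold powFreePart
  congr 1
  ext m
  exact and_congr_right fun _ => ⟨key ha hb h m, key hb ha h.symm m⟩

theorem powFreePart_eq_of_rpow_div_eq_ratCast {d : ℕ} (hd : d ≠ 0) {n n' : ℕ} (hn : 0 < n)
    (hn' : 0 < n') {q : ℚ} (hq : |(n : ℝ) ^ ((1 : ℝ) / d) / (n' : ℝ) ^ ((1 : ℝ) / d)| = q) :
    powFreePart d n = powFreePart d n' := by
  have hnR : (0 : ℝ) < n := by exact_mod_cast hn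
  have hnR' : (0 : ℝ) < n' := by exact_mod_cast hn'
  rw [abs_of_pos (by positivity)] at hq
  have hq0 : 0 < q := by
    have : (0 : ℝ) < q := hq ▸ by positivity
    exact_mod_cast this
  have hpow : (n : ℝ) / n' = (q : ℝ) ^ d := by
    rw [← hq, div_pow, one_div, Real.rpow_inv_natCast_pow hnR.le hd,
      Real.rpow_inv_natCast_pow hnR'.le hd]
  have hpowQ : (n : ℚ) / n' = q ^ d := by
    apply Rat.cast_injective (α := ℝ)
    push_cast
    exact hpow
  have hnum : 0 < q.num := Rat.num_pos.2 hq0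
  refine powFreePart_eq_of_mul_pow_eq q.den_pos (Int.natAbs_pos.2 hnum.ne') ?_
  have hnumQ : ((q.num.natAbs : ℕ) : ℚ) = q.num := by
    rw [Nat.cast_natAbs, abs_of_pos hnum]
  have hden : (q.den : ℚ) ≠ 0 := by exact_mod_cast q.den_ne_zero
  have hnQ' : (n' : ℚ) ≠ 0 := by exact_mod_cast hn'.ne'
  rw [← Rat.num_div_den q, div_pow, div_eq_div_iff hnQ' (pow_ne_zero _ hden)] at hpowQ
  have : ((n * q.den ^ d : ℕ) : ℚ) = ((n' * q.num.natAbs ^ d : ℕ) : ℚ) := by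
    push_cast [hnumQ]
    rw [hpowQ, mul_comm]
  exact_mod_cast this

theorem summable_prod_fin {α : Type*} {f : α → ℝ} (hf : Summable f) (hf0 : ∀ a, 0 ≤ f a)
    (k : ℕ) : Summable fun n : Fin k → α => ∏ j, f (n j) := by
  induction k with
  | zero => exact Summable.of_finite
  | succ k ih =>
    rw [← (Fin.consEquiv fun _ : Fin (k + 1) => α).summable_iff]
    simpa [Function.comp_def, Fin.consEquiv, Fin.prod_univ_succ] using
      hf.mul_of_nonneg ih hf0 fun n => Finset.prod_nonneg fun j _ => hf0 (n j)

/-- If every fibre of `r` over its range has at least two elements, the weights of the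
pulled-back tuple `m ∘ r` are dominated by the squared weights of `m`. -/
theorem prod_comp_le_prod_sq {ι : Type*} [Fintype ι] {w : ι → ℝ} (hw0 : ∀ i, 0 ≤ w i)
    (hw1 : ∀ i, w i ≤ 1) {r : ι → ι} (hr : ∀ j, ∃ i ≠ j, r i = r j)
    (hw : ∀ i ∉ Set.range r, w i = 1) : ∏ j, w (r j) ≤ ∏ i, w i ^ 2 := by
  classical
  rw [Finset.prod_comp w r]
  have hsub : ∏ b ∈ Finset.univ.image r, w b ^ 2 = ∏ i, w i ^ 2 :=
    Finset.prod_subset (Finset.subset_univ _) fun i _ hi => by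
      rw [hw i (by simpa using hi), one_pow]
  rw [← hsub]
  refine Finset.prod_le_prod (fun i _ => pow_nonneg (hw0 i) _) fun i hi => ?_
  obtain ⟨j, -, rfl⟩ := Finset.mem_image.1 hi
  obtain ⟨i, hij, hrij⟩ := hr j
  refine pow_le_pow_of_le_one (hw0 _) (hw1 _) ?_
  exact Finset.one_lt_card.2 ⟨i, by simp [hrij], j, by simp, hij⟩

/-- The weighted sum over tuples of positive integers in which the `d`-th power free part of
each entry is shared by another entry converges. -/
theorem summable_prod_rpow_of_powFreePart {d : ℕ} {s : ℝ} (hs : 1 < 2 * s)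
    (hds : 1 < d * s) {k : ℕ} (S : Set (Fin k → ℕ)) (hpos : ∀ n ∈ S, ∀ j, 0 < n j)
    (hpair : ∀ n ∈ S, ∀ j, ∃ i ≠ j, powFreePart d (n i) = powFreePart d (n j)) :
    Summable fun n : S => ∏ j, (n.1 j : ℝ) ^ (-s) := by
  let F : (Fin k → Fin k) × ((Fin k → ℕ) × (Fin k → ℕ)) → ℝ := fun p =>
    1 * ((∏ i, (p.2.1 i : ℝ) ^ (-(2 * s))) * ∏ j, (p.2.2 j : ℝ) ^ (-(d * s)))
  have hF : Summable F := by
    have h1 := summable_prod_fin (Real.summable_nat_rpow.2 (neg_lt_neg hs))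
      (fun n => Real.rpow_nonneg n.cast_nonneg _) k
    have h2 := summable_prod_fin (Real.summable_nat_rpow.2 (neg_lt_neg hds))
      (fun n => Real.rpow_nonneg n.cast_nonneg _) k
    have h3 := h1.mul_of_nonneg h2 (fun n => by dsimp; positivity)
      (fun n => by dsimp; positivity)
    have h0 : Summable fun _ : Fin k → Fin k => (1 : ℝ) := Summable.of_finite
    exact h0.mul_of_nonneg h3 (fun _ => zero_le_one) fun n => by dsimp; positivity
  have hcode : ∀ n : S, ∃ p : (Fin k → Fin k) × ((Fin k → ℕ) × (Fin k → ℕ)),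
      (∀ j, n.1 j = p.2.1 (p.1 j) * p.2.2 j ^ d) ∧ ∏ j, (n.1 j : ℝ) ^ (-s) ≤ F p := by
    classical
    rintro ⟨n, hn⟩
    choose h hh0 hh using fun j => exists_eq_powFreePart_mul_pow d (hpos n hn j)
    obtain ⟨r, hr, hr'⟩ : ∃ r : Fin k → Fin k,
        (∀ j, powFreePart d (n (r j)) = powFreePart d (n j)) ∧
        ∀ i j, powFreePart d (n i) = powFreePart d (n j) → r i = r j := by
      let R : Setoid (Fin k) := Setoid.ker fun j => powFreePart d (n j)
      refine ⟨fun j => (Quotient.mk R j).out, fun j => ?_, fun i j hij => ?_⟩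
      · exact Quotient.exact (s := R) (Quotient.out_eq _)
      · exact congrArg _ (Quotient.sound (s := R) hij)
    let m : Fin k → ℕ := fun i => if i ∈ Set.range r then powFreePart d (n i) else 1
    have hm1 : ∀ i, 1 ≤ m i := fun i => by
      dsimp only [m]
      split_ifs
      · exact (powFreePart_mem d (hpos n hn i)).1
      · exact le_rfl
    have hnm : ∀ j, n j = m (r j) * h j ^ d := fun j => by
      simp only [m, Set.mem_range_self, if_true, hr]
      exact hh j
    refine ⟨(r, m, h), hnm, ?_⟩
    have hterm : ∀ j, (n j : ℝ) ^ (-s) = (m (r j) : ℝ) ^ (-s) * (h j : ℝ) ^ (-(d * s)) :=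
      fun j => by
        conv_lhs => rw [hnm j]
        push_cast
        rw [Real.mul_rpow (by positivity) (by positivity), ← Real.rpow_natCast,
          ← Real.rpow_mul (by positivity), mul_neg]
    have hle : ∏ j, (m (r j) : ℝ) ^ (-s) ≤ ∏ i, ((m i : ℝ) ^ (-s)) ^ 2 := by
      refine prod_comp_le_prod_sq (w := fun i => (m i : ℝ) ^ (-s)) (fun i => by positivity)
        (fun i => ?_) (fun j => ?_) fun i hi => ?_
      · exact Real.rpow_le_one_of_one_le_of_nonpos (by exact_mod_cast hm1 i) (by linarith)
      · obtain ⟨i, hij, he⟩ := hpair n hn j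
        exact ⟨i, hij, hr' i j he⟩
      · simp only [m, if_neg hi, Nat.cast_one, Real.one_rpow]
    have hsq : ∀ i, ((m i : ℝ) ^ (-s)) ^ 2 = (m i : ℝ) ^ (-(2 * s)) := fun i => by
      rw [← Real.rpow_natCast, ← Real.rpow_mul (by positivity)]
      congr 1
      push_cast
      ring
    simp only [hsq] at hle
    simp only [F, hterm, Finset.prod_mul_distrib, one_mul]
    exact mul_le_mul_of_nonneg_right hle (by positivity)
  choose code hcode hbound using hcode
  have hinj : Function.Injective code := fun n n' h => by
    ext j
    rw [hcode n j, hcode n' j, h]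
  exact Summable.of_nonneg_of_le (fun n => by positivity) hbound (hF.comp_injective hinj)

/-- Each term of a solution of `∑_{P j} n_j^{1/d} = ∑_{¬ P j} n_j^{1/d}` shares its `d`-th
power free part with another term. -/
theorem exists_ne_powFreePart_eq {ι : Type*} [Fintype ι] {d : ℕ} (hd : d ≠ 0)
    (P : ι → Prop) [DecidablePred P] {n : ι → ℕ} (hpos : ∀ j, 0 < n j)
    (heq : ∑ j with P j, (n j : ℝ) ^ ((1 : ℝ) / d) =
      ∑ j with ¬ P j, (n j : ℝ) ^ ((1 : ℝ) / d)) (j : ι) :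
    ∃ i ≠ j, powFreePart d (n i) = powFreePart d (n j) := by
  let x : ι → ℝ := fun i => (if P i then 1 else -1) * (n i : ℝ) ^ ((1 : ℝ) / d)
  have habs : ∀ i, |(if P i then 1 else -1 : ℝ)| = 1 := fun i => by split_ifs <;> simp
  have hx : ∀ i, ∃ q : ℚ, x i ^ d = q := fun i => by
    refine ⟨(if P i then 1 else -1) ^ d * n i, ?_⟩
    simp only [x, mul_pow, one_div, Real.rpow_inv_natCast_pow (Nat.cast_nonneg (n i)) hd]
    split_ifs <;> simp
  have hsum : ∑ i, x i = 0 := by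
    rw [← Finset.sum_filter_add_sum_filter_not Finset.univ P,
      Finset.sum_congr rfl (g := fun i => (n i : ℝ) ^ ((1 : ℝ) / d)) (fun i hi => by
        simp [x, (Finset.mem_filter.1 hi).2]), heq, ← Finset.sum_add_distrib]
    refine Finset.sum_eq_zero fun i hi => ?_
    simp [x, (Finset.mem_filter.1 hi).2]
  have hj : x j ≠ 0 := by
    have : (0 : ℝ) < n j := by exact_mod_cast hpos j
    refine mul_ne_zero (fun h => ?_) (by positivity)
    simpa [h] using habs j
  obtain ⟨i, hij, q, hq⟩ := exists_ne_div_eq_ratCast_of_sum_eq_zero hd hx hsum hj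
  refine ⟨i, hij, powFreePart_eq_of_rpow_div_eq_ratCast hd (hpos i) (hpos j) (q := |q|) ?_⟩
  rw [Rat.cast_abs, ← hq]
  simp only [x, abs_div, abs_mul, habs, one_mul]

theorem stmt_7 (c : ℕ → ℝ) (hc0 : ∀ n, 0 ≤ c n)
    (hc : ∀ ε : ℝ, 0 < ε → ∃ K : ℝ, 0 < K ∧ ∀ n : ℕ, 1 ≤ n → c n ≤ K * (n : ℝ) ^ ε)
    (k : ℕ) (hk : k = 3 ∨ k = 4 ∨ k = 5) (l : ℕ) (hl1 : 1 ≤ l) (hl2 : l ≤ k - 1) :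
    Summable (fun n : {n : Fin k → ℕ // (∀ j, 0 < n j) ∧
        ∑ j ∈ Finset.univ.filter (fun j : Fin k => (j : ℕ) < l), ((n j : ℝ)) ^ ((1 : ℝ) / 4) =
          ∑ j ∈ Finset.univ.filter (fun j : Fin k => l ≤ (j : ℕ)), ((n j : ℝ)) ^ ((1 : ℝ) / 4)} =>
      |(∏ j, c (n.1 j)) / (∏ j, (n.1 j : ℝ)) ^ ((7 : ℝ) / 8)|) := by
  obtain ⟨K, hK, hcK⟩ := hc (1 / 8) (by norm_num)
  have hS := summable_prod_rpow_of_powFreePart (d := 4) (s := 3 / 4) (by norm_num)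
    (by norm_num) {n : Fin k → ℕ | (∀ j, 0 < n j) ∧
        ∑ j ∈ Finset.univ.filter (fun j : Fin k => (j : ℕ) < l), ((n j : ℝ)) ^ ((1 : ℝ) / 4) =
          ∑ j ∈ Finset.univ.filter (fun j : Fin k => l ≤ (j : ℕ)), ((n j : ℝ)) ^ ((1 : ℝ) / 4)}
    (fun n hn => hn.1) fun n hn => exists_ne_powFreePart_eq (by norm_num)
      (fun j : Fin k => (j : ℕ) < l) hn.1 (by simpa only [not_lt, Nat.cast_ofNat] using hn.2)
  refine Summable.of_nonneg_of_le (fun n => abs_nonneg _) (fun n => ?_) (hS.mul_left (K ^ k))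
  have hn : ∀ j, (0 : ℝ) < n.1 j := fun j => by exact_mod_cast n.2.1 j
  rw [abs_of_nonneg (div_nonneg (Finset.prod_nonneg fun j _ => hc0 _) (by positivity)),
    ← Real.finsetProd_rpow _ _ (fun j _ => (hn j).le), ← Finset.prod_div_distrib]
  calc ∏ j, c (n.1 j) / (n.1 j : ℝ) ^ ((7 : ℝ) / 8)
      ≤ ∏ j, K * (n.1 j : ℝ) ^ (-(3 / 4 : ℝ)) := by
        refine Finset.prod_le_prod (fun j _ => div_nonneg (hc0 _) (by positivity)) fun j _ => ?_
        rw [div_le_iff₀ (Real.rpow_pos_of_pos (hn j) _), mul_assoc, ← Real.rpow_add (hn j)]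
        norm_num
        simpa using hcK _ (n.2.1 j)
    _ = K ^ k * ∏ j, (n.1 j : ℝ) ^ (-(3 / 4 : ℝ)) := by
        simp [Finset.prod_mul_distrib]
end
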